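/- arXiv:math-ph/0501043 — 6 statements merged into one kernel-verified Lean document; each statement's English description precedes it below -/
import Mathlib

section
/- Let c > 0 and β > -1 be real numbers, and for x ∈ (0,1) set A(x) = (β+1)|log(1-x)| + β·log|log(1-x)| + β·log(β+1) + log c. Then for every real t, as x → 1⁻, the infinite product ∏_{k ∈ ℕ, k > (A(x)+t)/(1-x)} (1-x^k)^{c·k^β} converges to exp(-e^{-t}). -/
open Filter Topology

lemma exp_neg_abs_mul_le_one_add_rpow (β : ℝ) {y : ℝ} (hy : 0 ≤ y) :
    Real.exp (-|β| * y) ≤ (1 + y) ^ β := by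
  rw [Real.rpow_def_of_pos (by linarith), Real.exp_le_exp]
  have h0 : 0 ≤ Real.log (1 + y) := Real.log_nonneg (by linarith)
  have h1 : Real.log (1 + y) ≤ y := by
    linarith [Real.log_le_sub_one_of_pos (show 0 < 1 + y by linarith)]
  nlinarith [neg_abs_le β, abs_nonneg β]

lemma one_add_rpow_le_exp_abs_mul (β : ℝ) {y : ℝ} (hy : 0 ≤ y) :
    (1 + y) ^ β ≤ Real.exp (|β| * y) := by
  rw [Real.rpow_def_of_pos (by linarith), Real.exp_le_exp]
  have h0 : 0 ≤ Real.log (1 + y) := Real.log_nonneg (by linarith)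
  have h1 : Real.log (1 + y) ≤ y := by
    linarith [Real.log_le_sub_one_of_pos (show 0 < 1 + y by linarith)]
  nlinarith [le_abs_self β, abs_nonneg β]

lemma le_neg_log_one_sub {z : ℝ} (hz : z < 1) : z ≤ -Real.log (1 - z) := by
  linarith [Real.log_le_sub_one_of_pos (show 0 < 1 - z by linarith)]

lemma neg_log_one_sub_le_div {z w : ℝ} (hz : 0 ≤ z) (hzw : z ≤ w) (hw : w < 1) :
    -Real.log (1 - z) ≤ z / (1 - w) := by
  have h1 : 0 < 1 - z := by linarith
  have h2 := Real.one_sub_inv_le_log_of_pos h1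
  have h3 : (1 - z)⁻¹ - 1 = z / (1 - z) := by field_simp; ring
  have h4 : z / (1 - z) ≤ z / (1 - w) :=
    div_le_div_of_nonneg_left hz (by linarith) (by linarith)
  linarith

lemma natCast_add_rpow_mul_pow (β x : ℝ) {N : ℕ} (hN : 0 < N) (j : ℕ) :
    ((N + j : ℕ) : ℝ) ^ β * x ^ (N + j)
      = (N : ℝ) ^ β * x ^ N * ((1 + (j : ℝ) / N) ^ β * x ^ j) := by
  have hN' : (0 : ℝ) < N := by exact_mod_cast hN
  have h : ((N + j : ℕ) : ℝ) = N * (1 + (j : ℝ) / N) := by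
    push_cast; field_simp
  rw [h, Real.mul_rpow hN'.le (by positivity), pow_add]
  ring

lemma mul_exp_div_pow (x a : ℝ) (N j : ℕ) :
    (x * Real.exp (a / N)) ^ j = Real.exp (a * ((j : ℝ) / N)) * x ^ j := by
  rw [mul_pow, ← Real.exp_nat_mul, mul_comm]
  congr 2
  ring

/-- Two-sided geometric bounds for the logarithm of the tail of the Bose–Einstein product. -/
lemma exists_hasSum_tail (c β x : ℝ) (hc : 0 < c) (hx0 : 0 < x) (hx1 : x < 1) {N : ℕ}
    (hN : 0 < N) (hq : x * Real.exp (|β| / N) < 1) :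
    ∃ S, HasSum (fun j : ℕ => -(c * ((N + j : ℕ) : ℝ) ^ β * Real.log (1 - x ^ (N + j)))) S ∧
      c * (N : ℝ) ^ β * x ^ N / (1 - x * Real.exp (-|β| / N)) ≤ S ∧
      S ≤ c * (N : ℝ) ^ β * x ^ N / (1 - x * Real.exp (|β| / N)) / (1 - x ^ N) := by
  have hN' : (0 : ℝ) < N := by exact_mod_cast hN
  have hxN : x ^ N < 1 := pow_lt_one₀ hx0.le hx1 hN.ne'
  set f : ℕ → ℝ := fun j => -(c * ((N + j : ℕ) : ℝ) ^ β * Real.log (1 - x ^ (N + j))) with hf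
  have hxj : ∀ j, x ^ (N + j) ≤ x ^ N := fun j =>
    pow_le_pow_of_le_one hx0.le hx1.le (by omega)
  have hlow : ∀ j, c * (N : ℝ) ^ β * x ^ N * (x * Real.exp (-|β| / N)) ^ j ≤ f j := by
    intro j
    have h1 := exp_neg_abs_mul_le_one_add_rpow β (show 0 ≤ (j : ℝ) / N by positivity)
    calc c * (N : ℝ) ^ β * x ^ N * (x * Real.exp (-|β| / N)) ^ j
        ≤ c * (N : ℝ) ^ β * x ^ N * ((1 + (j : ℝ) / N) ^ β * x ^ j) := by
          rw [mul_exp_div_pow]; gcongr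
      _ = c * ((N + j : ℕ) : ℝ) ^ β * x ^ (N + j) := by
          rw [mul_assoc c _ (x ^ (N + j)), natCast_add_rpow_mul_pow β x hN]; ring
      _ ≤ c * ((N + j : ℕ) : ℝ) ^ β * -Real.log (1 - x ^ (N + j)) := by
          gcongr; exact le_neg_log_one_sub ((hxj j).trans_lt hxN)
      _ = f j := by simp only [hf]; ring
  have hupp : ∀ j, f j ≤
      c * (N : ℝ) ^ β * x ^ N / (1 - x ^ N) * (x * Real.exp (|β| / N)) ^ j := by
    intro j
    have h1 := one_add_rpow_le_exp_abs_mul β (show 0 ≤ (j : ℝ) / N by positivity)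
    have h2 : 0 < 1 - x ^ N := by linarith
    calc f j = c * ((N + j : ℕ) : ℝ) ^ β * -Real.log (1 - x ^ (N + j)) := by
          simp only [hf]; ring
      _ ≤ c * ((N + j : ℕ) : ℝ) ^ β * (x ^ (N + j) / (1 - x ^ N)) := by
          gcongr; exact neg_log_one_sub_le_div (by positivity) (hxj j) hxN
      _ = c * (((N + j : ℕ) : ℝ) ^ β * x ^ (N + j)) / (1 - x ^ N) := by ring
      _ = c * (N : ℝ) ^ β * x ^ N / (1 - x ^ N) * ((1 + (j : ℝ) / N) ^ β * x ^ j) := by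
          rw [natCast_add_rpow_mul_pow β x hN]; ring
      _ ≤ _ := by rw [mul_exp_div_pow]; gcongr
  have hq' : x * Real.exp (-|β| / N) < 1 := by
    refine lt_of_le_of_lt ?_ hq
    gcongr
    linarith [abs_nonneg β]
  have hsl := (hasSum_geometric_of_lt_one (by positivity) hq').mul_left
    (c * (N : ℝ) ^ β * x ^ N)
  have hsu := (hasSum_geometric_of_lt_one (by positivity) hq).mul_left
    (c * (N : ℝ) ^ β * x ^ N / (1 - x ^ N))
  have hs : Summable f := Summable.of_nonneg_of_le
    (fun j => le_trans (by positivity) (hlow j)) hupp hsu.summable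
  refine ⟨_, hs.hasSum, ?_, ?_⟩
  · rw [div_eq_mul_inv]; exact hasSum_le hlow hsl hs.hasSum
  · refine (hasSum_le hupp hs.hasSum hsu).trans_eq ?_
    ring

lemma hasProd_tail (c β x : ℝ) (hx0 : 0 < x) (hx1 : x < 1) {M : ℝ} (hM : 0 ≤ M) {S : ℝ}
    (hS : HasSum (fun j : ℕ => -(c * ((⌊M⌋₊ + 1 + j : ℕ) : ℝ) ^ β *
      Real.log (1 - x ^ (⌊M⌋₊ + 1 + j)))) S) :
    HasProd (fun k : ℕ => if M < (k : ℝ) then (1 - x ^ k) ^ (c * (k : ℝ) ^ β) else 1)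
      (Real.exp (-S)) := by
  have hlt : ∀ k : ℕ, M < (k : ℝ) ↔ ⌊M⌋₊ + 1 ≤ k := fun k => by
    rw [← Nat.floor_lt hM]; omega
  have hinj : Function.Injective (fun j : ℕ => ⌊M⌋₊ + 1 + j) := add_right_injective _
  have h := hS.neg.rexp
  refine (hinj.hasProd_iff ?_).1 (h.congr_fun ?_)
  · intro k hk
    rw [if_neg]
    rw [hlt]
    intro hle
    exact hk ⟨k - (⌊M⌋₊ + 1), by simp only; omega⟩
  · intro j
    have hj : M < ((⌊M⌋₊ + 1 + j : ℕ) : ℝ) := (hlt _).2 (by omega)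
    have hpow : x ^ (⌊M⌋₊ + 1 + j) < 1 := pow_lt_one₀ hx0.le hx1 (by omega)
    simp only [Function.comp_apply, if_pos hj]
    rw [Real.rpow_def_of_pos (by linarith)]
    congr 1
    ring

section Asymptotics

variable {ι : Type*} {l : Filter ι}

lemma tendsto_div_one_sub_mul_exp {δ N : ι → ℝ} (hδ : Tendsto δ l (𝓝 0))
    (hδ0 : ∀ᶠ i in l, 0 < δ i) (hN : Tendsto (fun i => N i * δ i) l atTop) (s : ℝ) :
    Tendsto (fun i => (1 - (1 - δ i) * Real.exp (s / N i)) / δ i) l (𝓝 1) := by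
  have hu : Tendsto (fun i => s / (N i * δ i)) l (𝓝 0) := hN.const_div_atTop s
  have hsN : Tendsto (fun i => s / N i) l (𝓝 0) := by
    have := hu.mul hδ
    rw [mul_zero] at this
    refine this.congr' ?_
    filter_upwards [hδ0, hN.eventually_gt_atTop 0] with i hi hNi
    have : N i ≠ 0 := by rintro h; simp [h] at hNi
    field_simp
  have hexp : Tendsto (fun i => (Real.exp (s / N i) - 1) / δ i) l (𝓝 0) := by
    have h2 : Tendsto (fun i => 2 * |s / (N i * δ i)|) l (𝓝 0) := by
      simpa using hu.abs.const_mul 2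
    refine squeeze_zero_norm' ?_ h2
    have hsmall : ∀ᶠ i in l, |s / N i| ≤ 1 := by
      have := hsN.abs
      rw [abs_zero] at this
      exact (this.eventually_lt_const one_pos).mono fun _ h => h.le
    filter_upwards [hδ0, hsmall] with i hi hsi
    rw [Real.norm_eq_abs, abs_div, abs_of_pos hi, div_le_iff₀ hi]
    refine (Real.abs_exp_sub_one_le hsi).trans_eq ?_
    rw [abs_div, abs_div, abs_mul, abs_of_pos hi]
    field_simp
  have := (((tendsto_const_nhds (x := (1 : ℝ))).sub hδ).mul hexp).const_sub 1
  rw [mul_zero, sub_zero] at this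
  refine this.congr' ?_
  filter_upwards [hδ0] with i hi
  field_simp
  ring

end Asymptotics

lemma neg_log_sub_one_sub_le {x : ℝ} (hx : 0 < x) :
    -Real.log x - (1 - x) ≤ (1 - x) * (1 - x) / x := by
  have h := Real.one_sub_inv_le_log_of_pos hx
  have : x⁻¹ - 1 - (1 - x) = (1 - x) * (1 - x) / x := by field_simp
  linarith

lemma exp_neg_gumbel_scale (c β t : ℝ) (hc : 0 < c) (hβ : -1 < β) {a x L δ : ℝ} {N : ℕ}
    (hN : 0 < N) (hx : 0 < x) (hL : 0 < L) (hδ : 0 < δ) (hLδ : L = -Real.log δ)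
    (ha : a = (β + 1) * L + β * Real.log L + β * Real.log (β + 1) + Real.log c) :
    (N * δ / L / (β + 1)) ^ β * Real.exp (-t) * Real.exp (a + t - N * -Real.log x)
      = c * (N : ℝ) ^ β * x ^ N / δ := by
  have hN' : (0 : ℝ) < N := by exact_mod_cast hN
  have hb : 0 < β + 1 := by linarith
  rw [← Real.exp_log (show 0 < c * (N : ℝ) ^ β * x ^ N / δ by positivity),
    Real.log_div (by positivity) hδ.ne', Real.log_mul (by positivity) (by positivity),
    Real.log_mul hc.ne' (by positivity), Real.log_rpow hN', Real.log_pow,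
    Real.rpow_def_of_pos (by positivity), ← Real.exp_add, ← Real.exp_add,
    Real.log_div (by positivity) hb.ne', Real.log_div (by positivity) hL.ne',
    Real.log_mul hN'.ne' hδ.ne', ha]
  have : Real.log δ = -L := by linarith
  rw [this]
  congr 1
  ring

/-- **Theorem 1 (Vershik–Yakubovich).** For the generalized Bose–Einstein
multiplicative statistics with `b_k = c * k ^ β` (`c > 0`, `β > -1`), the probability
`∏_{k > (A(x)+t)/(1-x)} (1-x^k)^(c k^β)` that the maximal summand, rescaled,
is at most `t` converges to the Gumbel distribution function `exp (-exp (-t))`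
as `x → 1⁻`. -/
theorem stmt_0 (c β : ℝ) (hc : 0 < c) (hβ : -1 < β)
    (A : ℝ → ℝ)
    (hA : ∀ x : ℝ, A x = (β + 1) * |Real.log (1 - x)| + β * Real.log |Real.log (1 - x)|
      + β * Real.log (β + 1) + Real.log c)
    (t : ℝ) :
    Tendsto (fun x : ℝ => ∏' k : ℕ,
        if (A x + t) / (1 - x) < (k : ℝ) then (1 - x ^ k) ^ (c * (k : ℝ) ^ β) else 1)
      (𝓝[<] 1) (𝓝 (Real.exp (-Real.exp (-t)))) := by
  have hb : 0 < β + 1 := by linarith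
  set l : Filter ℝ := 𝓝[<] (1 : ℝ)
  set L : ℝ → ℝ := fun x => |Real.log (1 - x)|
  set N : ℝ → ℕ := fun x => ⌊(A x + t) / (1 - x)⌋₊ + 1 with hNdef
  have hid : Tendsto (fun x : ℝ => x) l (𝓝 1) := tendsto_id.mono_left nhdsWithin_le_nhds
  have hx1 : ∀ᶠ x in l, x < 1 := eventually_mem_nhdsWithin
  have hx0 : ∀ᶠ x in l, 0 < x := hid.eventually_const_lt one_pos
  have hδ0 : ∀ᶠ x in l, 0 < 1 - x := hx1.mono fun x hx => by linarith
  have hδ : Tendsto (fun x : ℝ => 1 - x) l (𝓝 0) := by simpa using hid.const_sub 1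
  have hδ' : Tendsto (fun x : ℝ => 1 - x) l (𝓝[>] 0) :=
    tendsto_nhdsWithin_iff.2 ⟨hδ, hδ0⟩
  have hL : Tendsto L l atTop :=
    tendsto_abs_atBot_atTop.comp (Real.tendsto_log_nhdsGT_zero.comp hδ')
  have hL0 : ∀ᶠ x in l, 0 < L x := hL.eventually_gt_atTop 0
  have hLneg : ∀ᶠ x in l, L x = -Real.log (1 - x) := by
    filter_upwards [hx0, hx1] with x h0 h1
    exact abs_of_nonpos (Real.log_nonpos (by linarith) (by linarith))
  have hLδ : Tendsto (fun x => L x * (1 - x)) l (𝓝 0) := by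
    have h := (Real.continuous_mul_log.tendsto 0).comp hδ
    simp only [Real.log_zero, mul_zero] at h
    have h' := h.neg
    rw [neg_zero] at h'
    refine h'.congr' ?_
    filter_upwards [hLneg] with x hx
    rw [hx, Function.comp_apply]; ring
  have hAL : Tendsto (fun x => (A x + t) / L x) l (𝓝 (β + 1)) := by
    have h1 : Tendsto (fun x => Real.log (L x) / L x) l (𝓝 0) :=
      Real.isLittleO_log_id_atTop.tendsto_div_nhds_zero.comp hL
    have h2 := hL.const_div_atTop (β * Real.log (β + 1) + Real.log c + t)
    have h3 := ((h1.const_mul β).const_add (β + 1)).add h2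
    rw [mul_zero, add_zero, add_zero] at h3
    refine h3.congr' ?_
    filter_upwards [hL0] with x hx
    have : A x = (β + 1) * L x + β * Real.log (L x) + β * Real.log (β + 1) + Real.log c := hA x
    rw [this]
    field_simp
    ring
  have hAt : Tendsto (fun x => A x + t) l atTop := by
    refine (hAL.pos_mul_atTop hb hL).congr' ?_
    filter_upwards [hL0] with x hx
    field_simp
  have hr : ∀ᶠ x in l, 0 ≤ N x * (1 - x) - (A x + t) ∧
      N x * (1 - x) - (A x + t) ≤ 1 - x := by
    filter_upwards [hδ0, hAt.eventually_ge_atTop 0] with x hx hAx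
    have h1 := Nat.lt_floor_add_one ((A x + t) / (1 - x))
    have h2 := Nat.floor_le (show 0 ≤ (A x + t) / (1 - x) by positivity)
    rw [div_lt_iff₀ hx] at h1
    rw [le_div_iff₀ hx] at h2
    simp only [hNdef]
    push_cast
    constructor <;> nlinarith
  have hr0 : Tendsto (fun x => N x * (1 - x) - (A x + t)) l (𝓝 0) :=
    squeeze_zero' (hr.mono fun _ h => h.1) (hr.mono fun _ h => h.2) hδ
  have hNδ : Tendsto (fun x => N x * (1 - x)) l atTop :=
    tendsto_atTop_mono' l (hr.mono fun x h => by linarith [h.1]) hAt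
  have hNL : Tendsto (fun x => N x * (1 - x) / L x) l (𝓝 (β + 1)) := by
    have h := hAL.add (hr0.mul (tendsto_inv_atTop_zero.comp hL))
    rw [mul_zero, add_zero] at h
    refine h.congr fun x => ?_
    simp only [Function.comp_apply]
    ring
  have hNδδ : Tendsto (fun x => N x * (1 - x) * (1 - x)) l (𝓝 0) := by
    have h := hNL.mul hLδ
    rw [mul_zero] at h
    refine h.congr' ?_
    filter_upwards [hL0] with x hx
    field_simp
  have hNθ : Tendsto (fun x => A x + t - N x * -Real.log x) l (𝓝 0) := by
    have hu : Tendsto (fun x => N x * (1 - x) * (1 - x) / x) l (𝓝 0) := by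
      have h := hNδδ.div hid one_ne_zero
      rwa [zero_div] at h
    have h1 : Tendsto (fun x => N x * (-Real.log x - (1 - x))) l (𝓝 0) := by
      refine squeeze_zero' ?_ ?_ hu
      · filter_upwards [hx0] with x hx
        have := Real.log_le_sub_one_of_pos hx
        exact mul_nonneg (Nat.cast_nonneg _) (by linarith)
      · filter_upwards [hx0] with x hx
        have := mul_le_mul_of_nonneg_left (neg_log_sub_one_sub_le hx)
          (Nat.cast_nonneg (α := ℝ) (N x))
        refine this.trans_eq (by ring)
    have h2 := (h1.add hr0).neg
    rw [add_zero, neg_zero] at h2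
    exact h2.congr fun x => by ring
  have hmain : Tendsto (fun x => c * (N x : ℝ) ^ β * x ^ N x / (1 - x)) l
      (𝓝 (Real.exp (-t))) := by
    have h1 := ((hNL.div_const (β + 1)).rpow_const (p := β)
      (Or.inl (by rw [div_self hb.ne']; exact one_ne_zero))).mul_const (Real.exp (-t))
    have h2 := h1.mul ((Real.continuous_exp.tendsto 0).comp hNθ)
    rw [div_self hb.ne', Real.one_rpow, one_mul, Real.exp_zero, mul_one] at h2
    refine h2.congr' ?_
    filter_upwards [hx0, hδ0, hL0, hLneg] with x hx hδx hLx hLn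
    exact exp_neg_gumbel_scale c β t hc hβ (Nat.succ_pos _) hx hLx hδx hLn (hA x)
  have hpow : Tendsto (fun x => x ^ N x) l (𝓝 0) := by
    have h := Real.tendsto_exp_neg_atTop_nhds_zero.comp hNδ
    refine squeeze_zero' (hx0.mono fun x hx => by positivity) ?_ h
    filter_upwards [hx0] with x hx
    rw [Function.comp_apply, ← Real.exp_log (pow_pos hx (N x)), Real.log_pow, Real.exp_le_exp]
    nlinarith [Real.log_le_sub_one_of_pos hx, Nat.cast_nonneg (α := ℝ) (N x)]
  have hden : ∀ s : ℝ, Tendsto (fun x => (1 - x * Real.exp (s / N x)) / (1 - x)) l (𝓝 1) := by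
    intro s
    simpa using tendsto_div_one_sub_mul_exp hδ hδ0 hNδ s
  have hlow : Tendsto (fun x => c * (N x : ℝ) ^ β * x ^ N x /
      (1 - x * Real.exp (-|β| / N x))) l (𝓝 (Real.exp (-t))) := by
    have h := hmain.div (hden (-|β|)) one_ne_zero
    rw [div_one] at h
    refine h.congr' ?_
    filter_upwards [hδ0] with x hx
    exact div_div_div_cancel_right₀ hx.ne' _ _
  have hupp : Tendsto (fun x => c * (N x : ℝ) ^ β * x ^ N x /
      (1 - x * Real.exp (|β| / N x)) / (1 - x ^ N x)) l (𝓝 (Real.exp (-t))) := by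
    have h := (hmain.div (hden |β|) one_ne_zero).div (hpow.const_sub 1) (by norm_num)
    rw [div_one, sub_zero, div_one] at h
    refine h.congr' ?_
    filter_upwards [hδ0] with x hx
    simp only [Pi.div_apply]
    rw [div_div_div_cancel_right₀ hx.ne']
  have hq : ∀ᶠ x in l, x * Real.exp (|β| / N x) < 1 := by
    filter_upwards [hδ0, (hden |β|).eventually_const_lt one_pos] with x hx h
    have := (div_pos_iff_of_pos_right hx).1 h
    linarith
  refine tendsto_of_tendsto_of_tendsto_of_le_of_le'
    ((Real.continuous_exp.tendsto _).comp hupp.neg)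
    ((Real.continuous_exp.tendsto _).comp hlow.neg) ?_ ?_ <;>
  · filter_upwards [hx0, hx1, hδ0, hAt.eventually_ge_atTop 0, hq] with x h0 h1 hδx hAx hqx
    obtain ⟨S, hS, hSl, hSu⟩ := exists_hasSum_tail c β x hc h0 h1 (Nat.succ_pos _) hqx
    rw [(hasProd_tail c β x h0 h1 (by positivity) hS).tprod_eq]
    simp only [Function.comp_apply]
    gcongr
end

section
/- Let c > 0 and β > -1 be real numbers. For x ∈ (0,1) and each positive integer k, let ν_{x,k} be the probability measure on ℕ given by ν_{x,k}({j}) = ((b_k)_j / j!) · x^{kj} · (1-x^k)^{b_k}, where b_k = c·k^β and (b)_j = b(b+1)⋯(b+j-1) is the ascending factorial, and let ν_x be the product probability measure of the ν_{x,k} on the space of functions r : ℕ⁺ → ℕ. Set A(x) = (β+1)|log(1-x)| + β·log|log(1-x)| + β·log(β+1) + log c. Then for every real t, ν_x({r : r_k = 0 for all integers k > (A(x)+t)/(1-x)}) → exp(-e^{-t}) as x → 1⁻. -/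
open Filter Topology MeasureTheory

/-- If the finite-dimensional zero probabilities factorise as exponentials, then the probability
that all coordinates from `N + 1` on vanish is the exponential of the infinite sum. -/
lemma measure_tail_eq_zero_toReal (ν : Measure (ℕ+ → ℕ)) [IsProbabilityMeasure ν]
    (N : ℕ) (g : ℕ → ℝ) (hg : Summable g)
    (hν : ∀ m : ℕ, ν {r | ∀ j < m, r (Nat.succPNat (N + j)) = 0}
      = ENNReal.ofReal (Real.exp (-∑ j ∈ Finset.range m, g j))) :
    (ν {r | ∀ k : ℕ+, N < (k : ℕ) → r k = 0}).toReal = Real.exp (-∑' j, g j) := by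
  have hset : {r : ℕ+ → ℕ | ∀ k : ℕ+, N < (k : ℕ) → r k = 0}
      = ⋂ m : ℕ, {r | ∀ j < m, r (Nat.succPNat (N + j)) = 0} := by
    ext r
    simp only [Set.mem_ofPred_eq, Set.mem_iInter]
    constructor
    · intro h m j _
      exact h _ (by simp only [Nat.succPNat_coe]; omega)
    · intro h k hk
      have := h (k - N) (k - N - 1) (by omega)
      have hk' : Nat.succPNat (N + ((k : ℕ) - N - 1)) = k := by
        apply PNat.eq
        simp only [Nat.succPNat_coe]
        omega
      rwa [hk'] at this
  have hmeas : ∀ m : ℕ, MeasurableSet {r : ℕ+ → ℕ | ∀ j < m, r (Nat.succPNat (N + j)) = 0} := by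
    intro m
    have : {r : ℕ+ → ℕ | ∀ j < m, r (Nat.succPNat (N + j)) = 0}
        = ⋂ j : ℕ, ⋂ _ : j < m, (fun r : ℕ+ → ℕ => r (Nat.succPNat (N + j))) ⁻¹' {0} := by
      ext r
      simp
    rw [this]
    exact MeasurableSet.iInter fun j => MeasurableSet.iInter fun _ =>
      measurable_pi_apply _ (measurableSet_singleton 0)
  have hlim := tendsto_measure_iInter_atTop (μ := ν) (fun m => (hmeas m).nullMeasurableSet)
    (fun m m' hmm r hr j hj => hr j (lt_of_lt_of_le hj hmm)) ⟨0, measure_ne_top _ _⟩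
  rw [← hset] at hlim
  have hlim' := (ENNReal.tendsto_toReal (measure_ne_top ν _)).comp hlim
  refine tendsto_nhds_unique hlim' ?_
  have hexp : Tendsto (fun m => Real.exp (-∑ j ∈ Finset.range m, g j)) atTop
      (𝓝 (Real.exp (-∑' j, g j))) :=
    (Real.continuous_exp.tendsto _).comp hg.hasSum.tendsto_sum_nat.neg
  refine hexp.congr fun m => ?_
  simp only [Function.comp_apply, hν m]
  rw [ENNReal.toReal_ofReal (Real.exp_pos _).le]

lemma rpow_one_add_mem_Icc (β u : ℝ) (hu : 0 ≤ u) :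
    min 1 (Real.exp (β * u)) ≤ (1 + u) ^ β ∧ (1 + u) ^ β ≤ max 1 (Real.exp (β * u)) := by
  have h1 : 0 < 1 + u := by linarith
  have hlog : 0 ≤ Real.log (1 + u) := Real.log_nonneg (by linarith)
  have hlog' : Real.log (1 + u) ≤ u := by
    have := Real.log_le_sub_one_of_pos h1
    linarith
  rw [Real.rpow_def_of_pos h1, mul_comm _ β]
  rcases le_total 0 β with hβ | hβ
  · exact ⟨(min_le_left _ _).trans (Real.one_le_exp (mul_nonneg hβ hlog)),
      le_max_of_le_right (Real.exp_le_exp.2 (mul_le_mul_of_nonneg_left hlog' hβ))⟩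
  · exact ⟨(min_le_right _ _).trans (Real.exp_le_exp.2 (mul_le_mul_of_nonpos_left hlog' hβ)),
      le_max_of_le_left (Real.exp_le_one_iff.2 (mul_nonpos_of_nonpos_of_nonneg hβ hlog))⟩

lemma rpow_add_nat_bounds (β : ℝ) (n j : ℕ) (hn : 0 < n) :
    (n : ℝ) ^ β * min 1 (Real.exp (β / n)) ^ j ≤ ((n + j : ℕ) : ℝ) ^ β ∧
      ((n + j : ℕ) : ℝ) ^ β ≤ (n : ℝ) ^ β * max 1 (Real.exp (β / n)) ^ j := by
  have hn' : (0 : ℝ) < n := by exact_mod_cast hn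
  have hsplit : ((n + j : ℕ) : ℝ) ^ β = (n : ℝ) ^ β * (1 + j / n) ^ β := by
    rw [← Real.mul_rpow hn'.le (by positivity)]
    congr 1
    push_cast
    field_simp
  have hpow : Real.exp (β / n) ^ j = Real.exp (β * (j / n)) := by
    rw [← Real.exp_nat_mul]
    congr 1
    ring
  obtain ⟨hlo, hhi⟩ := rpow_one_add_mem_Icc β (j / n) (by positivity)
  have hp : 0 < (n : ℝ) ^ β := Real.rpow_pos_of_pos hn' β
  have he := (Real.exp_pos (β / n)).le
  rw [hsplit]
  constructor
  · refine mul_le_mul_of_nonneg_left (le_trans ?_ hlo) hp.le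
    refine le_min (pow_le_one₀ (by positivity) (min_le_left _ _)) ?_
    rw [← hpow]
    exact pow_le_pow_left₀ (by positivity) (min_le_right _ _) _
  · refine mul_le_mul_of_nonneg_left (hhi.trans ?_) hp.le
    refine max_le (one_le_pow₀ (le_max_left _ _)) ?_
    rw [← hpow]
    exact pow_le_pow_left₀ he (le_max_right _ _) _

lemma neg_log_one_sub_bounds {y : ℝ} (hy1 : y < 1) :
    y ≤ -Real.log (1 - y) ∧ -Real.log (1 - y) ≤ y / (1 - y) := by
  have h : 0 < 1 - y := by linarith
  constructor
  · have := Real.log_le_sub_one_of_pos h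
    linarith
  · have := Real.one_sub_inv_le_log_of_pos h
    have h2 : y / (1 - y) = (1 - y)⁻¹ - 1 := by
      field_simp
      ring
    linarith

/-- Geometric bounds for the tail sum of `-c k ^ β log (1 - x ^ k)` over `k ≥ n`. -/
lemma tail_sum_bounds {c β x : ℝ} (hc : 0 < c) (hx0 : 0 < x) (hx1 : x < 1) {n : ℕ} (hn : 0 < n)
    (hq : x * max 1 (Real.exp (β / n)) < 1) :
    Summable (fun j : ℕ => c * ((n + j : ℕ) : ℝ) ^ β * -Real.log (1 - x ^ (n + j))) ∧
    c * (n : ℝ) ^ β * x ^ n * (1 - x * min 1 (Real.exp (β / n)))⁻¹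
      ≤ ∑' j : ℕ, c * ((n + j : ℕ) : ℝ) ^ β * -Real.log (1 - x ^ (n + j)) ∧
    ∑' j : ℕ, c * ((n + j : ℕ) : ℝ) ^ β * -Real.log (1 - x ^ (n + j))
      ≤ c * (n : ℝ) ^ β * x ^ n * (1 - x ^ n)⁻¹ * (1 - x * max 1 (Real.exp (β / n)))⁻¹ := by
  set q₁ := min 1 (Real.exp (β / n)) with hq₁
  set q₂ := max 1 (Real.exp (β / n)) with hq₂
  have hq₁0 : 0 < q₁ := lt_min one_pos (Real.exp_pos _)
  have hq₂0 : 0 < q₂ := lt_max_of_lt_left one_pos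
  have hq₁' : x * q₁ < 1 := lt_of_le_of_lt
    (mul_le_mul_of_nonneg_left ((min_le_left _ _).trans (le_max_left _ _)) hx0.le) hq
  have hn' : (0 : ℝ) < n := by exact_mod_cast hn
  have hxn : x ^ n < 1 := pow_lt_one₀ hx0.le hx1 hn.ne'
  have hpow : ∀ j : ℕ, x ^ (n + j) ≤ x ^ n := fun j =>
    pow_le_pow_of_le_one hx0.le hx1.le (Nat.le_add_right _ _)
  have hk : ∀ j : ℕ, 0 < ((n + j : ℕ) : ℝ) ^ β := fun j =>
    Real.rpow_pos_of_pos (by exact_mod_cast Nat.add_pos_left hn j) _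
  have hlo : ∀ j : ℕ, c * (n : ℝ) ^ β * x ^ n * (x * q₁) ^ j
      ≤ c * ((n + j : ℕ) : ℝ) ^ β * -Real.log (1 - x ^ (n + j)) := by
    intro j
    have h1 := (neg_log_one_sub_bounds ((hpow j).trans_lt hxn)).1
    have h2 := (rpow_add_nat_bounds β n j hn).1
    calc c * (n : ℝ) ^ β * x ^ n * (x * q₁) ^ j
        = c * ((n : ℝ) ^ β * q₁ ^ j) * x ^ (n + j) := by rw [mul_pow, pow_add]; ring
      _ ≤ c * ((n + j : ℕ) : ℝ) ^ β * -Real.log (1 - x ^ (n + j)) := by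
        refine mul_le_mul (mul_le_mul_of_nonneg_left h2 hc.le) h1 (by positivity) ?_
        exact (mul_pos hc (hk j)).le
  have hhi : ∀ j : ℕ, c * ((n + j : ℕ) : ℝ) ^ β * -Real.log (1 - x ^ (n + j))
      ≤ c * (n : ℝ) ^ β * x ^ n * (1 - x ^ n)⁻¹ * (x * q₂) ^ j := by
    intro j
    have h1 := (neg_log_one_sub_bounds ((hpow j).trans_lt hxn)).2
    have h0 := (neg_log_one_sub_bounds ((hpow j).trans_lt hxn)).1
    have h2 := (rpow_add_nat_bounds β n j hn).2
    have h3 : x ^ (n + j) / (1 - x ^ (n + j)) ≤ x ^ (n + j) * (1 - x ^ n)⁻¹ := by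
      rw [div_eq_mul_inv]
      refine mul_le_mul_of_nonneg_left ?_ (by positivity)
      exact inv_anti₀ (by linarith) (by linarith [hpow j])
    calc c * ((n + j : ℕ) : ℝ) ^ β * -Real.log (1 - x ^ (n + j))
        ≤ c * ((n : ℝ) ^ β * q₂ ^ j) * (x ^ (n + j) * (1 - x ^ n)⁻¹) := by
          refine mul_le_mul (mul_le_mul_of_nonneg_left h2 hc.le) (h1.trans h3)
            (le_trans (by positivity) h0) (by positivity)
      _ = _ := by rw [mul_pow, pow_add]; ring
  have hs₁ := (hasSum_geometric_of_lt_one (by positivity) hq₁').mul_left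
    (c * (n : ℝ) ^ β * x ^ n)
  have hs₂ := (hasSum_geometric_of_lt_one (by positivity) hq).mul_left
    (c * (n : ℝ) ^ β * x ^ n * (1 - x ^ n)⁻¹)
  have hsum : Summable (fun j : ℕ => c * ((n + j : ℕ) : ℝ) ^ β * -Real.log (1 - x ^ (n + j))) :=
    Summable.of_nonneg_of_le (fun j => le_trans (by positivity) (hlo j)) hhi hs₂.summable
  exact ⟨hsum, hasSum_le hlo hs₁ hsum.hasSum, hasSum_le hhi hsum.hasSum hs₂⟩

lemma tendsto_one_sub_nhdsLT_one : Tendsto (fun x : ℝ => 1 - x) (𝓝[<] 1) (𝓝[>] 0) := by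
  refine tendsto_nhdsWithin_iff.2 ⟨?_, ?_⟩
  · have : Tendsto (fun x : ℝ => 1 - x) (𝓝 1) (𝓝 (1 - 1)) := tendsto_const_nhds.sub tendsto_id
    rw [sub_self] at this
    exact this.mono_left nhdsWithin_le_nhds
  · filter_upwards [self_mem_nhdsWithin] with x hx
    simpa using hx

lemma tendsto_abs_log_one_sub : Tendsto (fun x : ℝ => |Real.log (1 - x)|) (𝓝[<] 1) atTop :=
  tendsto_abs_atBot_atTop.comp (Real.tendsto_log_nhdsGT_zero.comp tendsto_one_sub_nhdsLT_one)

lemma tendsto_abs_log_one_sub_mul :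
    Tendsto (fun x : ℝ => |Real.log (1 - x)| * (1 - x)) (𝓝[<] 1) (𝓝 0) := by
  have h := ((tendsto_log_mul_rpow_nhdsGT_zero one_pos).comp tendsto_one_sub_nhdsLT_one).abs
  rw [abs_zero] at h
  refine h.congr' ?_
  filter_upwards [self_mem_nhdsWithin] with x hx
  have hx' : 0 < 1 - x := by simpa using hx
  simp only [Function.comp_apply, Real.rpow_one, abs_mul, abs_of_pos hx']

section Asymptotics

variable {c β t : ℝ} {A : ℝ → ℝ} {n : ℝ → ℕ}

lemma tendsto_centering_div (hA : ∀ x : ℝ, A x = (β + 1) * |Real.log (1 - x)|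
      + β * Real.log |Real.log (1 - x)| + β * Real.log (β + 1) + Real.log c) :
    Tendsto (fun x => (A x + t) / |Real.log (1 - x)|) (𝓝[<] 1) (𝓝 (β + 1)) := by
  have hL := tendsto_abs_log_one_sub
  have h1 := (Real.isLittleO_log_id_atTop.tendsto_div_nhds_zero.comp hL).const_mul β
  have h2 := hL.inv_tendsto_atTop.const_mul (β * Real.log (β + 1) + Real.log c + t)
  have h := (h1.add h2).const_add (β + 1)
  simp only [mul_zero, add_zero] at h
  refine h.congr' ?_
  filter_upwards [hL.eventually_gt_atTop 0] with x hx
  simp only [Function.comp_apply, id, hA x, Pi.inv_apply]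
  field_simp
  ring

lemma tendsto_index_mul_div
    (hAL : Tendsto (fun x => (A x + t) / |Real.log (1 - x)|) (𝓝[<] 1) (𝓝 (β + 1)))
    (hn : Tendsto (fun x => n x * (1 - x) - (A x + t)) (𝓝[<] 1) (𝓝 0)) :
    Tendsto (fun x => n x * (1 - x) / |Real.log (1 - x)|) (𝓝[<] 1) (𝓝 (β + 1)) := by
  have h := hAL.add (hn.mul tendsto_abs_log_one_sub.inv_tendsto_atTop)
  simp only [mul_zero, add_zero] at h
  refine h.congr fun x => ?_
  simp only [Pi.inv_apply]
  ring

lemma tendsto_index_mul_log_add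
    (hw : Tendsto (fun x => n x * (1 - x) / |Real.log (1 - x)|) (𝓝[<] 1) (𝓝 (β + 1))) :
    Tendsto (fun x => n x * (Real.log x + (1 - x))) (𝓝[<] 1) (𝓝 0) := by
  have hx1 : Tendsto (fun x : ℝ => x⁻¹) (𝓝[<] 1) (𝓝 1) := by
    have := (tendsto_inv₀ (one_ne_zero (α := ℝ)))
    rw [inv_one] at this
    exact this.mono_left nhdsWithin_le_nhds
  have h := ((hw.mul tendsto_abs_log_one_sub_mul).mul hx1).neg
  simp only [mul_zero, zero_mul, neg_zero] at h
  have hev : ∀ᶠ x : ℝ in 𝓝[<] 1, 0 < x ∧ x < 1 := by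
    filter_upwards [Ioo_mem_nhdsLT (zero_lt_one' ℝ)] with x hx using hx
  refine tendsto_of_tendsto_of_tendsto_of_le_of_le' h tendsto_const_nhds ?_ ?_
  · filter_upwards [hev, tendsto_abs_log_one_sub.eventually_gt_atTop 0] with x hx hL
    have h1 := Real.one_sub_inv_le_log_of_pos hx.1
    have h2 : n x * (1 - x) / |Real.log (1 - x)| * (|Real.log (1 - x)| * (1 - x)) * x⁻¹
        = n x * ((1 - x) * (1 - x) * x⁻¹) := by
      field_simp
    rw [h2, ← mul_neg]
    refine mul_le_mul_of_nonneg_left ?_ (Nat.cast_nonneg _)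
    have h3 : (1 - x) * (1 - x) * x⁻¹ = x⁻¹ - 2 + x := by
      have := hx.1.ne'
      field_simp
      ring
    linarith
  · filter_upwards [hev] with x hx
    have h1 := Real.log_le_sub_one_of_pos hx.1
    exact mul_nonpos_of_nonneg_of_nonpos (Nat.cast_nonneg _) (by linarith)

lemma tendsto_leading_term (hc : 0 < c) (hβ : -1 < β)
    (hA : ∀ x : ℝ, A x = (β + 1) * |Real.log (1 - x)|
      + β * Real.log |Real.log (1 - x)| + β * Real.log (β + 1) + Real.log c)
    (hn0 : ∀ x, 0 < n x)
    (hn : Tendsto (fun x => n x * (1 - x) - (A x + t)) (𝓝[<] 1) (𝓝 0))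
    (hw : Tendsto (fun x => n x * (1 - x) / |Real.log (1 - x)|) (𝓝[<] 1) (𝓝 (β + 1))) :
    Tendsto (fun x => c * (n x : ℝ) ^ β * x ^ n x / (1 - x)) (𝓝[<] 1) (𝓝 (Real.exp (-t))) := by
  have hβ' : β + 1 ≠ 0 := by linarith
  have h1 := ((hw.log hβ').const_mul β).sub_const (β * Real.log (β + 1))
  have h := ((h1.sub hn).add (tendsto_index_mul_log_add hw)).sub_const t
  have h' := (Real.continuous_exp.tendsto _).comp h
  simp only [sub_self, add_zero, zero_sub] at h'
  refine h'.congr' ?_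
  filter_upwards [Ioo_mem_nhdsLT (zero_lt_one' ℝ),
    tendsto_abs_log_one_sub.eventually_gt_atTop 0] with x hx hL
  have hh : 0 < 1 - x := by linarith [hx.2]
  have hnx : (0 : ℝ) < n x := by exact_mod_cast hn0 x
  have hlogneg : |Real.log (1 - x)| = -Real.log (1 - x) :=
    abs_of_nonpos (Real.log_nonpos hh.le (by linarith [hx.1]))
  have hxn : x ^ n x = Real.exp (n x * Real.log x) := by
    rw [Real.exp_nat_mul, Real.exp_log hx.1]
  have hrhs : c * (n x : ℝ) ^ β * x ^ n x / (1 - x)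
      = Real.exp (Real.log c + Real.log (n x) * β + n x * Real.log x - Real.log (1 - x)) := by
    rw [Real.exp_sub, Real.exp_add, Real.exp_add, Real.exp_log hc, Real.exp_log hh,
      ← Real.rpow_def_of_pos hnx, hxn]
  rw [hrhs]
  simp only [Function.comp_apply]
  congr 1
  rw [Real.log_div (by positivity) hL.ne', Real.log_mul hnx.ne' hh.ne', hA x, hlogneg]
  ring

lemma tendsto_index_mul_atTop (hβ : -1 < β)
    (hw : Tendsto (fun x => n x * (1 - x) / |Real.log (1 - x)|) (𝓝[<] 1) (𝓝 (β + 1))) :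
    Tendsto (fun x => n x * (1 - x)) (𝓝[<] 1) atTop := by
  have h := hw.pos_mul_atTop (by linarith) tendsto_abs_log_one_sub
  refine h.congr' ?_
  filter_upwards [tendsto_abs_log_one_sub.eventually_gt_atTop 0] with x hL
  field_simp

lemma tendsto_pow_index (hnh : Tendsto (fun x => n x * (1 - x)) (𝓝[<] 1) atTop) :
    Tendsto (fun x : ℝ => x ^ n x) (𝓝[<] 1) (𝓝 0) := by
  have h := Real.tendsto_exp_neg_atTop_nhds_zero.comp hnh
  refine tendsto_of_tendsto_of_tendsto_of_le_of_le' tendsto_const_nhds h ?_ ?_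
  · filter_upwards [Ioo_mem_nhdsLT (zero_lt_one' ℝ)] with x hx
    exact pow_nonneg hx.1.le _
  · filter_upwards [Ioo_mem_nhdsLT (zero_lt_one' ℝ)] with x hx
    simp only [Function.comp_apply]
    rw [← mul_neg, Real.exp_nat_mul]
    refine pow_le_pow_left₀ hx.1.le ?_ _
    have := Real.add_one_le_exp (-(1 - x))
    linarith

lemma tendsto_exp_sub_one_div (hn0 : ∀ x, 0 < n x)
    (hnh : Tendsto (fun x => n x * (1 - x)) (𝓝[<] 1) atTop) :
    Tendsto (fun x => |Real.exp (β / n x) - 1| / (1 - x)) (𝓝[<] 1) (𝓝 0) := by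
  have h := hnh.inv_tendsto_atTop.const_mul (2 * |β|)
  rw [mul_zero] at h
  refine tendsto_of_tendsto_of_tendsto_of_le_of_le' tendsto_const_nhds h ?_ ?_
  · filter_upwards [Ioo_mem_nhdsLT (zero_lt_one' ℝ)] with x hx
    exact div_nonneg (abs_nonneg _) (by linarith [hx.2])
  · filter_upwards [Ioo_mem_nhdsLT (zero_lt_one' ℝ), hnh.eventually_ge_atTop |β|] with x hx hb
    have hh : 0 < 1 - x := by linarith [hx.2]
    have hnx : (0 : ℝ) < n x := by exact_mod_cast hn0 x
    have hsmall : |β / n x| ≤ 1 := by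
      rw [abs_div, abs_of_pos hnx, div_le_one hnx]
      nlinarith [hx.1]
    calc |Real.exp (β / n x) - 1| / (1 - x) ≤ 2 * |β / n x| / (1 - x) := by
          gcongr
          exact Real.abs_exp_sub_one_le hsmall
      _ = 2 * |β| * (n x * (1 - x))⁻¹ := by
          rw [abs_div, abs_of_pos hnx]
          field_simp

lemma tendsto_one_sub_mul_div {e q : ℝ → ℝ} (he : Tendsto (fun x => e x / (1 - x)) (𝓝[<] 1) (𝓝 0))
    (hq : ∀ x, |q x - 1| ≤ e x) :
    Tendsto (fun x => (1 - x * q x) / (1 - x)) (𝓝[<] 1) (𝓝 1) := by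
  have h0 : Tendsto (fun x => (1 - q x) / (1 - x)) (𝓝[<] 1) (𝓝 0) := by
    refine squeeze_zero_norm' ?_ he
    filter_upwards [Ioo_mem_nhdsLT (zero_lt_one' ℝ)] with x hx
    have hh : 0 < 1 - x := by linarith [hx.2]
    rw [Real.norm_eq_abs, abs_div, abs_of_pos hh, abs_sub_comm]
    gcongr
    exact hq x
  have hid : Tendsto (fun x : ℝ => x) (𝓝[<] 1) (𝓝 1) := nhdsWithin_le_nhds
  have h := (hid.mul h0).const_add 1
  simp only [mul_zero, add_zero] at h
  refine h.congr' ?_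
  filter_upwards [Ioo_mem_nhdsLT (zero_lt_one' ℝ)] with x hx
  have hh : 1 - x ≠ 0 := by linarith [hx.2]
  field_simp
  ring

lemma abs_min_one_sub_one_le (y : ℝ) : |min 1 y - 1| ≤ |y - 1| := by
  rcases le_total 1 y with h | h <;> simp [h]

lemma abs_max_one_sub_one_le (y : ℝ) : |max 1 y - 1| ≤ |y - 1| := by
  rcases le_total 1 y with h | h <;> simp [h]

lemma tendsto_tail_sum (hc : 0 < c) (hβ : -1 < β)
    (hA : ∀ x : ℝ, A x = (β + 1) * |Real.log (1 - x)|
      + β * Real.log |Real.log (1 - x)| + β * Real.log (β + 1) + Real.log c)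
    (hn0 : ∀ x, 0 < n x)
    (hn : Tendsto (fun x => n x * (1 - x) - (A x + t)) (𝓝[<] 1) (𝓝 0)) :
    (∀ᶠ x in 𝓝[<] 1, Summable
      (fun j : ℕ => c * ((n x + j : ℕ) : ℝ) ^ β * -Real.log (1 - x ^ (n x + j)))) ∧
    Tendsto (fun x => ∑' j : ℕ, c * ((n x + j : ℕ) : ℝ) ^ β * -Real.log (1 - x ^ (n x + j)))
      (𝓝[<] 1) (𝓝 (Real.exp (-t))) := by
  have hw := tendsto_index_mul_div (tendsto_centering_div (t := t) hA) hn
  have hnh := tendsto_index_mul_atTop hβ hw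
  have hP := tendsto_leading_term hc hβ hA hn0 hn hw
  have he := tendsto_exp_sub_one_div (β := β) hn0 hnh
  have hmin := tendsto_one_sub_mul_div he fun x => abs_min_one_sub_one_le (Real.exp (β / n x))
  have hmax := tendsto_one_sub_mul_div he fun x => abs_max_one_sub_one_le (Real.exp (β / n x))
  have hpow := (tendsto_pow_index hnh).const_sub 1
  rw [sub_zero] at hpow
  have hlo := hP.mul (hmin.inv₀ one_ne_zero)
  have hhi := (hP.mul (hpow.inv₀ one_ne_zero)).mul (hmax.inv₀ one_ne_zero)
  simp only [inv_one, mul_one] at hlo hhi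
  have hev : ∀ᶠ x : ℝ in 𝓝[<] 1, 0 < x ∧ x < 1 ∧ x * max 1 (Real.exp (β / n x)) < 1 := by
    filter_upwards [Ioo_mem_nhdsLT (zero_lt_one' ℝ), hmax.eventually_const_lt one_pos]
      with x hx hpos
    have hh : 0 < 1 - x := by linarith [hx.2]
    have := (div_pos_iff_of_pos_right hh).1 hpos
    exact ⟨hx.1, hx.2, by linarith⟩
  refine ⟨?_, tendsto_of_tendsto_of_tendsto_of_le_of_le' hlo hhi ?_ ?_⟩
  · filter_upwards [hev] with x ⟨h0, h1, hq⟩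
    exact (tail_sum_bounds hc h0 h1 (hn0 x) hq).1
  · filter_upwards [hev] with x ⟨h0, h1, hq⟩
    refine le_of_eq_of_le ?_ (tail_sum_bounds hc h0 h1 (hn0 x) hq).2.1
    have hh : 1 - x ≠ 0 := by linarith
    rw [inv_div]
    field_simp
  · filter_upwards [hev] with x ⟨h0, h1, hq⟩
    refine le_of_le_of_eq (tail_sum_bounds hc h0 h1 (hn0 x) hq).2.2 ?_
    have hh : 1 - x ≠ 0 := by linarith
    rw [inv_div]
    field_simp

end Asymptotics

lemma tendsto_floor_add_one_mul_sub {B : ℝ → ℝ} (hB : ∀ᶠ x in 𝓝[<] 1, 0 ≤ B x) :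
    Tendsto (fun x => ((⌊B x / (1 - x)⌋₊ + 1 : ℕ) : ℝ) * (1 - x) - B x) (𝓝[<] 1) (𝓝 0) := by
  have h := tendsto_one_sub_nhdsLT_one.mono_right nhdsWithin_le_nhds
  refine tendsto_of_tendsto_of_tendsto_of_le_of_le' tendsto_const_nhds h ?_ ?_
  all_goals
    filter_upwards [hB, self_mem_nhdsWithin] with x hBx hx
    have hh : 0 < 1 - x := by simpa using hx
    have hdiv : B x / (1 - x) * (1 - x) = B x := div_mul_cancel₀ _ hh.ne'
    push_cast
  · nlinarith [Nat.lt_floor_add_one (B x / (1 - x))]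
  · nlinarith [Nat.floor_le (div_nonneg hBx hh.le)]

/-- **Theorem 1 (Vershik–Yakubovich), occupation-number form.** Let `ν x` be the
product (grand canonical) measure on occupation numbers `r : ℕ+ → ℕ` whose `k`-th
marginal `μ x k` gives mass `((b_k)_j / j!) x^{kj} (1-x^k)^{b_k}` to `j`, where
`b_k = c k^β` and `(b)_j` is the ascending factorial. Then the `ν x`-probability
that `r k = 0` for all `k > (A(x)+t)/(1-x)` tends to `exp (-exp (-t))` as `x → 1⁻`. -/
theorem stmt_1 (c β : ℝ) (hc : 0 < c) (hβ : -1 < β)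
    (μ : ℝ → ℕ+ → Measure ℕ)
    (hμprob : ∀ x ∈ Set.Ioo (0 : ℝ) 1, ∀ k : ℕ+, IsProbabilityMeasure (μ x k))
    (hμ : ∀ x ∈ Set.Ioo (0 : ℝ) 1, ∀ k : ℕ+, ∀ j : ℕ,
      μ x k {j} = ENNReal.ofReal
        ((∏ i ∈ Finset.range j, (c * (k : ℝ) ^ β + i)) / (Nat.factorial j) *
          x ^ ((k : ℕ) * j) * (1 - x ^ (k : ℕ)) ^ (c * (k : ℝ) ^ β)))
    (ν : ℝ → Measure (ℕ+ → ℕ))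
    (hνprob : ∀ x ∈ Set.Ioo (0 : ℝ) 1, IsProbabilityMeasure (ν x))
    -- `ν x` is the product of the measures `μ x k`: cylinder sets have product measure
    (hν : ∀ x ∈ Set.Ioo (0 : ℝ) 1, ∀ S : Finset ℕ+, ∀ a : ℕ+ → ℕ,
      ν x {r | ∀ k ∈ S, r k = a k} = ∏ k ∈ S, μ x k {a k})
    (A : ℝ → ℝ)
    (hA : ∀ x : ℝ, A x = (β + 1) * |Real.log (1 - x)| + β * Real.log |Real.log (1 - x)|
      + β * Real.log (β + 1) + Real.log c)
    (t : ℝ) :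
    Tendsto (fun x : ℝ =>
        (ν x {r | ∀ k : ℕ+, (A x + t) / (1 - x) < (k : ℝ) → r k = 0}).toReal)
      (𝓝[<] 1) (𝓝 (Real.exp (-Real.exp (-t)))) := by
  have hM : Tendsto (fun x => A x + t) (𝓝[<] 1) atTop := by
    refine ((tendsto_centering_div (t := t) hA).pos_mul_atTop (by linarith)
      tendsto_abs_log_one_sub).congr' ?_
    filter_upwards [tendsto_abs_log_one_sub.eventually_gt_atTop 0] with x hL
    field_simp
  set n : ℝ → ℕ := fun x => ⌊(A x + t) / (1 - x)⌋₊ + 1 with hn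
  obtain ⟨hsum, htail⟩ := tendsto_tail_sum (n := n) hc hβ hA (fun x => Nat.succ_pos _)
    (tendsto_floor_add_one_mul_sub (hM.eventually_ge_atTop 0))
  refine ((Real.continuous_exp.tendsto _).comp htail.neg).congr' ?_
  filter_upwards [hsum, hM.eventually_ge_atTop 0, Ioo_mem_nhdsLT (zero_lt_one' ℝ)] with x hs hB hx
  have hh : 0 < 1 - x := by linarith [hx.2]
  have hprob := hνprob x hx
  have hset : {r : ℕ+ → ℕ | ∀ k : ℕ+, (A x + t) / (1 - x) < (k : ℝ) → r k = 0}
      = {r | ∀ k : ℕ+, ⌊(A x + t) / (1 - x)⌋₊ < (k : ℕ) → r k = 0} := by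
    simp only [Nat.floor_lt (div_nonneg hB hh.le)]
  rw [hset, measure_tail_eq_zero_toReal (ν x) _ _ hs]
  · rfl
  intro m
  have hinj : Function.Injective
      fun j : ℕ => Nat.succPNat (⌊(A x + t) / (1 - x)⌋₊ + j) := fun i j hij => by
    simpa using Nat.succPNat_injective hij
  have hcyl := hν x hx ((Finset.range m).map ⟨_, hinj⟩) (fun _ => 0)
  simp only [Finset.mem_map, Finset.mem_range, Function.Embedding.coeFn_mk,
    forall_exists_index, and_imp, forall_apply_eq_imp_iff₂, Finset.prod_map] at hcyl
  rw [hcyl, ← Finset.sum_neg_distrib, Real.exp_sum,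
    ENNReal.ofReal_prod_of_nonneg fun _ _ => (Real.exp_pos _).le]
  refine Finset.prod_congr rfl fun j _ => ?_
  have hidx : (Nat.succPNat (⌊(A x + t) / (1 - x)⌋₊ + j) : ℕ) = n x + j := by
    simp only [Nat.succPNat_coe, hn]
    omega
  have hpos : 0 < 1 - x ^ (n x + j) := by
    linarith [pow_lt_one₀ hx.1.le hx.2 (show n x + j ≠ 0 by simp only [hn]; omega)]
  rw [hμ x hx, hidx, Real.rpow_def_of_pos hpos]
  simp only [Finset.range_zero, Finset.prod_empty, Nat.factorial_zero, Nat.cast_one, div_one,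
    mul_zero, pow_zero, one_mul]
  congr 2
  ring
end

section
/- Let c > 0 and β > -1 be real, and set A(x) = (β+1)|log(1-x)| + β·log|log(1-x)| + β·log(β+1) + log c and M(x,t) = (A(x)+t)/(1-x) for x ∈ (0,1) and t ∈ ℝ. Then for every fixed real t, c · M(x,t)^β · x^{M(x,t)} / (1-x) → e^{-t} as x → 1⁻. -/
open Filter Topology

/-- `-log (1 - x) → ∞` as `x → 1⁻`. -/
theorem tendsto_neg_log_one_sub :
    Tendsto (fun x : ℝ => -Real.log (1 - x)) (𝓝[<] (1 : ℝ)) atTop := by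
  have h1 : Tendsto (fun x : ℝ => 1 - x) (𝓝[<] (1 : ℝ)) (𝓝[>] 0) := by
    refine tendsto_nhdsWithin_iff.2 ⟨?_, ?_⟩
    · have : Tendsto (fun x : ℝ => 1 - x) (𝓝 1) (𝓝 (1 - 1)) :=
        (continuous_const.sub continuous_id).tendsto 1
      rw [sub_self] at this
      exact this.mono_left nhdsWithin_le_nhds
    · filter_upwards [self_mem_nhdsWithin] with x hx
      exact sub_pos.2 (Set.mem_Iio.1 hx)
  exact tendsto_neg_atBot_atTop.comp (Real.tendsto_log_nhdsGT_zero.comp h1)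

/-- An affine-plus-logarithmic function of `L` is asymptotic to its linear part. -/
theorem tendsto_linear_add_log_div (a b k : ℝ) :
    Tendsto (fun L : ℝ => (a * L + b * Real.log L + k) / L) atTop (𝓝 a) := by
  have h1 : Tendsto (fun L : ℝ => Real.log L / L) atTop (𝓝 0) :=
    Real.isLittleO_log_id_atTop.tendsto_div_nhds_zero
  have h2 : Tendsto (fun L : ℝ => k / L) atTop (𝓝 0) :=
    tendsto_const_nhds.div_atTop tendsto_id
  have h := ((tendsto_const_nhds (x := a)).add (h1.const_mul b)).add h2
  simp only [mul_zero, add_zero] at h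
  refine h.congr' ?_
  filter_upwards [eventually_gt_atTop 0] with L hL
  field_simp

/-- **Calibration of the centering function.** With
`A(x) = (β+1)|log(1-x)| + β log|log(1-x)| + β log(β+1) + log c` and
`M(x,t) = (A(x)+t)/(1-x)`, one has `c M(x,t)^β x^{M(x,t)}/(1-x) → e^{-t}` as `x → 1⁻`. -/
theorem stmt_4 (c β : ℝ) (hc : 0 < c) (hβ : -1 < β)
    (A : ℝ → ℝ)
    (hA : ∀ x : ℝ, A x = (β + 1) * |Real.log (1 - x)| + β * Real.log |Real.log (1 - x)|
      + β * Real.log (β + 1) + Real.log c)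
    (M : ℝ → ℝ → ℝ)
    (hM : ∀ x t : ℝ, M x t = (A x + t) / (1 - x))
    (t : ℝ) :
    Tendsto (fun x : ℝ => c * (M x t) ^ β * x ^ (M x t) / (1 - x))
      (𝓝[<] (1 : ℝ)) (𝓝 (Real.exp (-t))) := by
  have hβ' : 0 < β + 1 := by linarith
  set L : ℝ → ℝ := fun x => -Real.log (1 - x) with hLdef
  have hL : Tendsto L (𝓝[<] (1 : ℝ)) atTop := tendsto_neg_log_one_sub
  have hLpos : ∀ᶠ x in 𝓝[<] (1 : ℝ), 0 < L x := hL.eventually_gt_atTop 0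
  have hx1 : ∀ᶠ x in 𝓝[<] (1 : ℝ), x < 1 := self_mem_nhdsWithin
  have hx0 : ∀ᶠ x in 𝓝[<] (1 : ℝ), 0 < x :=
    (lt_mem_nhds (zero_lt_one (α := ℝ))).filter_mono nhdsWithin_le_nhds
  have hS : ∀ᶠ x in 𝓝[<] (1 : ℝ), A x + t =
      (β + 1) * L x + β * Real.log (L x) + (β * Real.log (β + 1) + Real.log c + t) := by
    filter_upwards [hLpos] with x hx
    have : |Real.log (1 - x)| = L x := by
      rw [← abs_neg]; exact abs_of_pos hx
    rw [hA, this]; ring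
  have hratio : Tendsto (fun x => (A x + t) / L x) (𝓝[<] (1 : ℝ)) (𝓝 (β + 1)) := by
    refine ((tendsto_linear_add_log_div (β + 1) β
      (β * Real.log (β + 1) + Real.log c + t)).comp hL).congr' ?_
    filter_upwards [hS] with x hx
    rw [hx]; rfl
  have hSpos : ∀ᶠ x in 𝓝[<] (1 : ℝ), 0 < A x + t := by
    filter_upwards [hLpos, hratio.eventually_const_lt hβ'] with x h1 h2
    exact (div_pos_iff_of_pos_right h1).1 h2
  have hLx : Tendsto (fun x => L x * (1 - x)) (𝓝[<] (1 : ℝ)) (𝓝 0) := by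
    have h := (Real.tendsto_pow_mul_exp_neg_atTop_nhds_zero 1).comp hL
    refine h.congr' ?_
    filter_upwards [hx1] with x hx
    simp [hLdef, Real.exp_log (sub_pos.2 hx)]
  have hid : Tendsto (fun x : ℝ => x) (𝓝[<] (1 : ℝ)) (𝓝 1) :=
    tendsto_id.mono_left nhdsWithin_le_nhds
  have hbound : Tendsto (fun x => -((A x + t) / L x * (L x * (1 - x)) / x))
      (𝓝[<] (1 : ℝ)) (𝓝 0) := by
    simpa using ((hratio.mul hLx).div hid one_ne_zero).neg
  have herr : Tendsto (fun x => (A x + t) * (Real.log x / (1 - x) + 1))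
      (𝓝[<] (1 : ℝ)) (𝓝 0) := by
    refine tendsto_of_tendsto_of_tendsto_of_le_of_le' hbound tendsto_const_nhds ?_ ?_
    · filter_upwards [hLpos, hx1, hx0, hSpos] with x h1 h2 h3 h4
      have h5 : 0 < 1 - x := sub_pos.2 h2
      have h6 : -(1 / x) ≤ Real.log x / (1 - x) := by
        rw [le_div_iff₀ h5]
        have := Real.one_sub_inv_le_log_of_pos h3
        have e : -(1 / x) * (1 - x) = 1 - x⁻¹ := by field_simp; ring
        rwa [e]
      have e : -((A x + t) / L x * (L x * (1 - x)) / x) = (A x + t) * (-(1 / x) + 1) := by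
        field_simp; ring
      rw [e]
      gcongr
    · filter_upwards [hx1, hx0, hSpos] with x h2 h3 h4
      have h5 : 0 < 1 - x := sub_pos.2 h2
      have h6 : Real.log x / (1 - x) ≤ -1 := by
        rw [div_le_iff₀ h5]
        linarith [Real.log_le_sub_one_of_pos h3]
      exact mul_nonpos_of_nonneg_of_nonpos h4.le (by linarith)
  have hlog : Tendsto (fun x => β * (Real.log ((A x + t) / L x) - Real.log (β + 1)) - t
      + (A x + t) * (Real.log x / (1 - x) + 1)) (𝓝[<] (1 : ℝ)) (𝓝 (-t)) := by
    simpa using ((((hratio.log hβ'.ne').sub_const (Real.log (β + 1))).const_mul β).sub_const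
      t).add herr
  refine ((Real.continuous_exp.tendsto _).comp hlog).congr' ?_
  filter_upwards [hLpos, hx1, hx0, hSpos, hS] with x h1 h2 h3 h4 hSx
  have h5 : 0 < 1 - x := sub_pos.2 h2
  have hMpos : 0 < M x t := by rw [hM]; exact div_pos h4 h5
  have hlogM : Real.log (M x t) = Real.log (A x + t) + L x := by
    rw [hM, Real.log_div h4.ne' h5.ne']; simp [hLdef, sub_eq_add_neg]
  have hpos : 0 < c * M x t ^ β * x ^ M x t / (1 - x) := by positivity
  rw [Function.comp_apply, ← Real.exp_log hpos, Real.log_div (by positivity) h5.ne',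
    Real.log_mul (by positivity) (by positivity), Real.log_mul (by positivity) (by positivity),
    Real.log_rpow hMpos, Real.log_rpow h3, hlogM, Real.log_div h4.ne' h1.ne']
  have e1 : Real.log (1 - x) = -L x := by simp [hLdef]
  have e2 : M x t * Real.log x = (A x + t) * (Real.log x / (1 - x)) := by rw [hM]; ring
  rw [e1, e2]
  congr 1
  linear_combination hSx
end

section
/- Fix an integer d ≥ 1, let C_d = π^{d/2}/Γ(d/2+1), set A(x) = (d/2)|log(1-x)| + ((d-2)/2)·log|log(1-x)| + (d/2)·log(d/2) + log C_d, and M(x,t) = ⌊(A(x)+t)/|log x|⌋. Then for every fixed real t, C_d·(d/2)·x^{M(x,t)}·M(x,t)^{(d-2)/2}/|log x| → e^{-t} as x → 1⁻. -/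
open Filter Topology

/-- The quotient of `1 - x` by `-log x` tends to `1` as `x → 1⁻`. -/
lemma tendsto_one_sub_div_neg_log :
    Tendsto (fun x : ℝ => (1 - x) / -Real.log x) (𝓝[<] (1 : ℝ)) (𝓝 1) := by
  have h := (Real.hasDerivAt_log (one_ne_zero (α := ℝ))).tendsto_slope
  have h2 := (h.mono_left (nhdsWithin_mono (1 : ℝ) (s := Set.Iio 1)
    (fun x hx => ne_of_lt hx))).inv₀ (by norm_num)
  rw [inv_one, inv_one] at h2
  refine h2.congr fun x => ?_
  rw [slope_def_field, Real.log_one, sub_zero, inv_div, div_neg, ← neg_div, neg_sub]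

/-- Algebraic form of the calibration: with `m` in place of `M(x,t)`, `u = 1 - x` and
`l = -log x`, the main term splits off the factor `exp (-t)`. -/
lemma calibration_identity {C a u l m t A : ℝ} (hC : 0 < C) (ha : 0 < a) (hu : 0 < u)
    (hL : 0 < -Real.log u) (hl : 0 < l) (hm : 0 < m)
    (hA : A = a * -Real.log u + (a - 1) * Real.log (-Real.log u) + a * Real.log a + Real.log C) :
    C * a * Real.exp (-(l * m)) * m ^ (a - 1) / l =
      Real.exp (-t) * Real.exp (A + t - l * m) * (u / l) ^ a *
        (l * m / -Real.log u / a) ^ (a - 1) := by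
  set L := -Real.log u with hLdef
  have hlu : Real.log u = -L := by rw [hLdef, neg_neg]
  apply Real.log_injOn_pos (Set.mem_Ioi.2 (by positivity)) (Set.mem_Ioi.2 (by positivity))
  rw [Real.log_div (by positivity) hl.ne', Real.log_mul (by positivity) (by positivity),
    Real.log_mul (by positivity) (by positivity), Real.log_mul hC.ne' ha.ne',
    Real.log_mul (by positivity) (by positivity), Real.log_mul (by positivity) (by positivity),
    Real.log_mul (by positivity) (by positivity), Real.log_rpow hm,
    Real.log_rpow (by positivity), Real.log_rpow (by positivity),
    Real.log_div (by positivity) ha.ne', Real.log_div (by positivity) hL.ne',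
    Real.log_mul hl.ne' hm.ne', Real.log_div hu.ne' hl.ne', Real.log_exp, Real.log_exp,
    Real.log_exp, hlu, hA]
  ring

/-- **Calibration limit completing the proof of Theorem 2.** With
`C_d = π^{d/2}/Γ(d/2+1)`, the Bose-gas centering `A(x)` and
`M(x,t) = ⌊(A(x)+t)/|log x|⌋`, the main term
`C_d (d/2) x^{M(x,t)} M(x,t)^{(d-2)/2}/|log x|` tends to `e^{-t}` as `x → 1⁻`. -/
theorem stmt_10 (d : ℕ) (hd : 1 ≤ d)
    (Cd : ℝ) (hCd : Cd = Real.pi ^ ((d : ℝ) / 2) / Real.Gamma ((d : ℝ) / 2 + 1))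
    (A : ℝ → ℝ)
    (hA : ∀ x : ℝ, A x = ((d : ℝ) / 2) * |Real.log (1 - x)|
      + (((d : ℝ) - 2) / 2) * Real.log |Real.log (1 - x)|
      + ((d : ℝ) / 2) * Real.log ((d : ℝ) / 2) + Real.log Cd)
    (M : ℝ → ℝ → ℤ)
    (hM : ∀ x t : ℝ, M x t = ⌊(A x + t) / |Real.log x|⌋)
    (t : ℝ) :
    Tendsto (fun x : ℝ =>
        Cd * ((d : ℝ) / 2) * x ^ (M x t) * (M x t : ℝ) ^ (((d : ℝ) - 2) / 2)
          / |Real.log x|)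
      (𝓝[<] (1 : ℝ)) (𝓝 (Real.exp (-t))) := by
  have hd0 : (0 : ℝ) < d := by exact_mod_cast hd
  have hab : ((d : ℝ) - 2) / 2 = (d : ℝ) / 2 - 1 := by ring
  simp only [hab] at hA ⊢
  have ha : (0 : ℝ) < (d : ℝ) / 2 := by positivity
  generalize (d : ℝ) / 2 = a at *
  have hC : 0 < Cd := by
    rw [hCd]
    exact div_pos (Real.rpow_pos_of_pos Real.pi_pos _) (Real.Gamma_pos_of_pos (by positivity))
  have hIoo : ∀ᶠ x in 𝓝[<] (1 : ℝ), x ∈ Set.Ioo (0 : ℝ) 1 := Ioo_mem_nhdsLT one_pos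
  have hu : Tendsto (fun x : ℝ => 1 - x) (𝓝[<] (1 : ℝ)) (𝓝[>] 0) := by
    refine tendsto_nhdsWithin_iff.2 ⟨?_, ?_⟩
    · have : Tendsto (fun x : ℝ => 1 - x) (𝓝 1) (𝓝 (1 - 1)) := by
        exact (continuous_const.sub continuous_id).tendsto 1
      rw [sub_self] at this
      exact this.mono_left nhdsWithin_le_nhds
    · filter_upwards [hIoo] with x hx using sub_pos.2 hx.2
  have hL : Tendsto (fun x : ℝ => -Real.log (1 - x)) (𝓝[<] (1 : ℝ)) atTop :=
    tendsto_neg_atBot_atTop.comp (Real.tendsto_log_nhdsGT_zero.comp hu)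
  have hl : Tendsto (fun x : ℝ => -Real.log x) (𝓝[<] (1 : ℝ)) (𝓝 0) := by
    have := (Real.continuousAt_log (one_ne_zero (α := ℝ))).tendsto.neg
    rw [Real.log_one, neg_zero] at this
    exact this.mono_left nhdsWithin_le_nhds
  have hlpos : ∀ᶠ x in 𝓝[<] (1 : ℝ), 0 < -Real.log x := by
    filter_upwards [hIoo] with x hx using neg_pos.2 (Real.log_neg hx.1 hx.2)
  have hrem : Tendsto (fun x : ℝ => A x + t - -Real.log x * M x t) (𝓝[<] (1 : ℝ)) (𝓝 0) := by
    refine tendsto_of_tendsto_of_tendsto_of_le_of_le' tendsto_const_nhds hl ?_ ?_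
    · filter_upwards [hlpos] with x hx
      rw [hM, abs_of_neg (neg_pos.1 hx), sub_nonneg, mul_comm]
      exact (le_div_iff₀ hx).1 (Int.floor_le _)
    · filter_upwards [hlpos] with x hx
      rw [hM, abs_of_neg (neg_pos.1 hx)]
      have := (div_lt_iff₀ hx).1 (Int.lt_floor_add_one ((A x + t) / -Real.log x))
      linarith
  have hAL : Tendsto (fun x : ℝ => (A x + t) / -Real.log (1 - x)) (𝓝[<] (1 : ℝ)) (𝓝 a) := by
    have h1 : Tendsto (fun y : ℝ => a + (a - 1) * (Real.log y / y)
        + (a * Real.log a + Real.log Cd + t) / y) atTop (𝓝 (a + (a - 1) * 0 + 0)) :=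
      (((Real.isLittleO_log_id_atTop.tendsto_div_nhds_zero).const_mul _).const_add _).add
        (tendsto_const_nhds.div_atTop tendsto_id)
    rw [mul_zero, add_zero, add_zero] at h1
    refine (h1.comp hL).congr' ?_
    filter_upwards [hL.eventually_gt_atTop 0] with x hx
    rw [hA, abs_of_neg (neg_pos.1 hx), Function.comp_apply]
    have := hx.ne'
    generalize -Real.log (1 - x) = L at *
    field_simp
    ring
  have hML : Tendsto (fun x : ℝ => -Real.log x * M x t / -Real.log (1 - x))
      (𝓝[<] (1 : ℝ)) (𝓝 a) := by
    have h := hAL.sub (hrem.div_atTop hL)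
    rw [sub_zero] at h
    refine h.congr fun x => ?_
    rw [← sub_div, sub_sub_cancel]
  have hlim := ((((Real.continuous_exp.tendsto 0).comp hrem).const_mul (Real.exp (-t))).mul
    (tendsto_one_sub_div_neg_log.rpow_const (p := a) (Or.inl one_ne_zero))).mul
    ((hML.div_const a).rpow_const (p := a - 1) (Or.inl (div_ne_zero ha.ne' ha.ne')))
  rw [Real.exp_zero, div_self ha.ne', Real.one_rpow, Real.one_rpow, mul_one, mul_one,
    mul_one] at hlim
  refine hlim.congr' ?_
  filter_upwards [hIoo, hlpos, hL.eventually_gt_atTop 0, hML.eventually_const_lt ha]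
    with x hx hlx hLx hMx
  have hm : (0 : ℝ) < M x t :=
    pos_of_mul_pos_right ((div_pos_iff_of_pos_right hLx).1 hMx) hlx.le
  have hpow : x ^ M x t = Real.exp (-(-Real.log x * M x t)) := by
    rw [← Real.rpow_intCast, Real.rpow_def_of_pos hx.1, neg_mul, neg_neg]
  rw [hpow, abs_of_neg (neg_pos.1 hlx)]
  refine (calibration_identity hC ha (sub_pos.2 hx.2) hLx hlx hm ?_).symm
  rw [hA, abs_of_neg (neg_pos.1 hLx)]
end

section
/- For x ∈ (0,1) set A(x) = 2|log(1-x)| + log|log(1-x)| + log 2. Then for every real t, ∏_{k ∈ ℕ, k > (A(x)+t)/(1-x)} (1-x^k)^{k} → exp(-e^{-t}) as x → 1⁻. -/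
open Filter Topology

/-- The tail sum `∑_{k ≥ N} k x^k` in closed form. -/
theorem hasSum_ite_coe_mul_geometric {x : ℝ} (hx0 : 0 < x) (hx1 : x < 1) (N : ℕ) :
    HasSum (fun k : ℕ => if N ≤ k then (k : ℝ) * x ^ k else 0)
      (x ^ N * (N / (1 - x) + x / (1 - x) ^ 2)) := by
  have hn : ‖x‖ < 1 := by rwa [Real.norm_of_nonneg hx0.le]
  have h1 := hasSum_coe_mul_geometric_of_norm_lt_one hn
  have h2 := (hasSum_geometric_of_lt_one hx0.le hx1).mul_left (N : ℝ)
  have h3 := (h2.add h1).mul_left (x ^ N)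
  rw [← div_eq_mul_inv] at h3
  rw [← (add_left_injective N).hasSum_iff]
  · refine (congrArg (HasSum · _) (funext fun j => ?_)).mpr h3
    simp only [Function.comp, Nat.le_add_left, if_true]
    push_cast
    ring
  · intro k hk
    rw [if_neg]
    intro h
    exact hk ⟨k - N, Nat.sub_add_cancel h⟩

/-- Two-sided bounds for the tail product `∏_{k ≥ N} (1 - x^k)^k` by the tail sum. -/
theorem tprod_one_sub_pow_pow_bounds {x : ℝ} (hx0 : 0 < x) (hx1 : x < 1) {N : ℕ} (hN : N ≠ 0) :
    Real.exp (-(x ^ N * (N / (1 - x) + x / (1 - x) ^ 2) / (1 - x ^ N))) ≤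
        ∏' k : ℕ, (if N ≤ k then (1 - x ^ k) ^ k else 1) ∧
      ∏' k : ℕ, (if N ≤ k then (1 - x ^ k) ^ k else 1) ≤
        Real.exp (-(x ^ N * (N / (1 - x) + x / (1 - x) ^ 2))) := by
  have hS := hasSum_ite_coe_mul_geometric hx0 hx1 N
  set S := x ^ N * (N / (1 - x) + x / (1 - x) ^ 2)
  set f : ℕ → ℝ := fun k => if N ≤ k then (1 - x ^ k) ^ k else 1 with hf
  set g : ℕ → ℝ := fun k => if N ≤ k then (k : ℝ) * x ^ k else 0 with hg
  have hlt : ∀ k, N ≤ k → x ^ k < 1 := fun k hk => pow_lt_one₀ hx0.le hx1 (by omega)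
  have hNpos : 0 < 1 - x ^ N := sub_pos.2 (hlt N le_rfl)
  have hpos : ∀ k, 0 < f k := by
    intro k
    by_cases hk : N ≤ k
    · simp only [hf, if_pos hk]
      exact pow_pos (sub_pos.2 (hlt k hk)) k
    · simp [hf, hk]
  have hupper : ∀ k, Real.log (f k) ≤ -g k := by
    intro k
    by_cases hk : N ≤ k
    · simp only [hf, hg, if_pos hk, Real.log_pow]
      have := Real.log_le_sub_one_of_pos (sub_pos.2 (hlt k hk))
      calc (k : ℝ) * Real.log (1 - x ^ k) ≤ k * (-x ^ k) := by gcongr; linarith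
        _ = _ := by ring
    · simp [hf, hg, hk]
  have hlower : ∀ k, -(g k / (1 - x ^ N)) ≤ Real.log (f k) := by
    intro k
    by_cases hk : N ≤ k
    · simp only [hf, hg, if_pos hk, Real.log_pow]
      have hp := sub_pos.2 (hlt k hk)
      have h1 := Real.one_sub_inv_le_log_of_pos hp
      have h2 : x ^ k / (1 - x ^ k) ≤ x ^ k / (1 - x ^ N) := by
        have : x ^ k ≤ x ^ N := pow_le_pow_of_le_one hx0.le hx1.le hk
        gcongr
      have h3 : 1 - (1 - x ^ k)⁻¹ = -(x ^ k / (1 - x ^ k)) := by field_simp; ring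
      calc -((k : ℝ) * x ^ k / (1 - x ^ N)) = k * (-(x ^ k / (1 - x ^ N))) := by ring
        _ ≤ k * Real.log (1 - x ^ k) := by gcongr; linarith
    · simp [hf, hg, hk]
  have hU : HasSum (fun k => -g k) (-S) := hS.neg
  have hL : HasSum (fun k => -(g k / (1 - x ^ N))) (-(S / (1 - x ^ N))) := (hS.div_const _).neg
  have hsum : Summable fun k => Real.log (f k) := by
    have h0 : Summable fun k => Real.log (f k) - -(g k / (1 - x ^ N)) :=
      Summable.of_nonneg_of_le (fun k => sub_nonneg.2 (hlower k))
        (fun k => sub_le_sub_right (hupper k) _) (hU.summable.sub hL.summable)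
    simpa using h0.add hL.summable
  rw [← Real.rexp_tsum_eq_tprod hpos hsum]
  exact ⟨Real.exp_le_exp.2 (hasSum_le hlower hL hsum.hasSum),
    Real.exp_le_exp.2 (hasSum_le hupper hsum.hasSum hU)⟩

/-- If `n - y / (1 - x) ∈ (0, 1]`, then `x ^ n` is `exp (-y)` up to an explicit error in the
exponent. -/
theorem neg_mul_log_sub_bounds {x y n : ℝ} (hx0 : 0 < x) (hx1 : x < 1) (hy : 0 < y)
    (h1 : y < n * (1 - x)) (h2 : n * (1 - x) ≤ y + (1 - x)) :
    0 ≤ -(n * Real.log x) - y ∧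
      -(n * Real.log x) - y ≤ (y * (1 - x) + (1 - x) ^ 2) / x + (1 - x) := by
  have he : 0 < 1 - x := sub_pos.2 hx1
  have hn : 0 < n := pos_of_mul_pos_left (hy.trans h1) he.le
  have hl1 := Real.log_le_sub_one_of_pos hx0
  have hl2 := Real.one_sub_inv_le_log_of_pos hx0
  constructor
  · nlinarith
  · have h3 : -(n * Real.log x) ≤ n * (1 - x) / x := by
      have : -Real.log x ≤ (1 - x) / x := by
        have : (1 - x) / x = x⁻¹ - 1 := by field_simp
        linarith
      calc -(n * Real.log x) = n * -Real.log x := by ring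
        _ ≤ n * ((1 - x) / x) := by gcongr
        _ = _ := by ring
    have h4 : n * (1 - x) / x ≤ (y + (1 - x)) / x := by gcongr
    have h5 : (y + (1 - x)) / x = (y * (1 - x) + (1 - x) ^ 2) / x + (1 - x) + y := by
      field_simp
      ring
    linarith

theorem tendsto_neg_log_one_sub_atTop :
    Tendsto (fun x : ℝ => -Real.log (1 - x)) (𝓝[<] 1) atTop := by
  refine tendsto_neg_atBot_atTop.comp (Real.tendsto_log_nhdsGT_zero.comp ?_)
  refine tendsto_nhdsWithin_iff.2 ⟨?_, ?_⟩
  · have : Tendsto (fun x : ℝ => 1 - x) (𝓝 1) (𝓝 (1 - 1)) := tendsto_const_nhds.sub tendsto_id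
    rw [sub_self] at this
    exact this.mono_left nhdsWithin_le_nhds
  · filter_upwards [self_mem_nhdsWithin] with x hx
    exact sub_pos.2 (Set.mem_Iio.1 hx)

theorem tendsto_two_mul_add_log_add_const_div_atTop (c : ℝ) :
    Tendsto (fun L : ℝ => (2 * L + Real.log L + c) / L) atTop (𝓝 2) := by
  have h1 : Tendsto (fun L : ℝ => Real.log L / L) atTop (𝓝 0) :=
    Real.isLittleO_log_id_atTop.tendsto_div_nhds_zero
  have h2 : Tendsto (fun L : ℝ => c / L) atTop (𝓝 0) := tendsto_id.const_div_atTop c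
  have h3 := (tendsto_const_nhds (x := (2 : ℝ))).add (h1.add h2)
  rw [add_zero, add_zero] at h3
  refine h3.congr' ?_
  filter_upwards [eventually_gt_atTop 0] with L hL
  field_simp
  ring

/-- **Theorem 3 (height of a random 3D Young diagram).** For the Gibbs measure on
plane partitions, corresponding to `b_k = k`, with
`A(x) = 2|log(1-x)| + log|log(1-x)| + log 2`, the probability
`∏_{k > (A(x)+t)/(1-x)} (1-x^k)^k` that the (rescaled) height is at most `t`
tends to the Gumbel distribution function `exp (-exp (-t))` as `x → 1⁻`. -/
theorem stmt_11
    (A : ℝ → ℝ)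
    (hA : ∀ x : ℝ, A x = 2 * |Real.log (1 - x)| + Real.log |Real.log (1 - x)|
      + Real.log 2)
    (t : ℝ) :
    Tendsto (fun x : ℝ => ∏' k : ℕ,
        if (A x + t) / (1 - x) < (k : ℝ) then (1 - x ^ k) ^ k else 1)
      (𝓝[<] (1 : ℝ)) (𝓝 (Real.exp (-Real.exp (-t)))) := by
  set L : ℝ → ℝ := fun x => -Real.log (1 - x) with hLdef
  set y : ℝ → ℝ := fun x => A x + t with hydef
  set N : ℝ → ℕ := fun x => ⌊y x / (1 - x)⌋₊ + 1 with hNdef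
  set η : ℝ → ℝ := fun x => -(N x * Real.log x) - y x with hηdef
  have hLtop : Tendsto L (𝓝[<] 1) atTop := tendsto_neg_log_one_sub_atTop
  have hx1 : ∀ᶠ x : ℝ in 𝓝[<] 1, x < 1 := self_mem_nhdsWithin
  have hx0 : ∀ᶠ x : ℝ in 𝓝[<] 1, 0 < x :=
    nhdsWithin_le_nhds (lt_mem_nhds one_pos)
  have hLpos : ∀ᶠ x in 𝓝[<] 1, 0 < L x := hLtop.eventually_gt_atTop 0
  have hxlim : Tendsto (fun x : ℝ => x) (𝓝[<] 1) (𝓝 1) := tendsto_id.mono_left nhdsWithin_le_nhds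
  have hεlim : Tendsto (fun x : ℝ => 1 - x) (𝓝[<] 1) (𝓝 0) := by
    simpa using (tendsto_const_nhds (x := (1 : ℝ))).sub hxlim
  have hy : ∀ᶠ x in 𝓝[<] 1, y x = 2 * L x + Real.log (L x) + (Real.log 2 + t) := by
    filter_upwards [hLpos] with x hx
    have : |Real.log (1 - x)| = L x := by rw [← abs_neg]; exact abs_of_pos hx
    simp only [hydef, hA, this]
    ring
  have hyL : Tendsto (fun x => y x / L x) (𝓝[<] 1) (𝓝 2) := by
    refine ((tendsto_two_mul_add_log_add_const_div_atTop (Real.log 2 + t)).comp hLtop).congr' ?_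
    filter_upwards [hy] with x hx
    simp [hx]
  have hytop : Tendsto y (𝓝[<] 1) atTop := by
    refine (hyL.pos_mul_atTop two_pos hLtop).congr' ?_
    filter_upwards [hLpos] with x hx
    field_simp
  have hypos : ∀ᶠ x in 𝓝[<] 1, 0 < y x := hytop.eventually_gt_atTop 0
  have hyε : Tendsto (fun x => y x * (1 - x)) (𝓝[<] 1) (𝓝 0) := by
    have h1 := (Real.tendsto_pow_mul_exp_neg_atTop_nhds_zero 1).comp hLtop
    have h2 := hyL.mul h1
    rw [mul_zero] at h2
    refine h2.congr' ?_
    filter_upwards [hLpos, hx1] with x hx hx1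
    have : Real.exp (-L x) = 1 - x := by
      simp only [hLdef, neg_neg]
      exact Real.exp_log (sub_pos.2 hx1)
    simp only [Function.comp, this]
    field_simp
  have hNbd : ∀ᶠ x in 𝓝[<] 1, y x < N x * (1 - x) ∧ N x * (1 - x) ≤ y x + (1 - x) := by
    filter_upwards [hypos, hx1] with x hyx hx1
    have he : 0 < 1 - x := sub_pos.2 hx1
    have h1 := Nat.lt_floor_add_one (y x / (1 - x))
    have h2 := Nat.floor_le (div_pos hyx he).le
    rw [div_lt_iff₀ he] at h1
    rw [le_div_iff₀ he] at h2
    simp only [hNdef, Nat.cast_add, Nat.cast_one]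
    exact ⟨h1, by linarith⟩
  have hη : Tendsto η (𝓝[<] 1) (𝓝 0) := by
    have hup : Tendsto (fun x => (y x * (1 - x) + (1 - x) ^ 2) / x + (1 - x)) (𝓝[<] 1) (𝓝 0) := by
      simpa using ((hyε.add (hεlim.pow 2)).div hxlim one_ne_zero).add hεlim
    refine tendsto_of_tendsto_of_tendsto_of_le_of_le' tendsto_const_nhds hup ?_ ?_
    · filter_upwards [hx0, hx1, hypos, hNbd] with x h0 h1 h2 h3
      exact (neg_mul_log_sub_bounds h0 h1 h2 h3.1 h3.2).1
    · filter_upwards [hx0, hx1, hypos, hNbd] with x h0 h1 h2 h3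
      exact (neg_mul_log_sub_bounds h0 h1 h2 h3.1 h3.2).2
  have hexpη : Tendsto (fun x => Real.exp (-η x)) (𝓝[<] 1) (𝓝 1) := by
    simpa [Function.comp_def] using (Real.continuous_exp.tendsto _).comp hη.neg
  have hpow : ∀ᶠ x in 𝓝[<] 1, x ^ N x = Real.exp (-y x) * Real.exp (-η x) := by
    filter_upwards [hx0] with x h0
    rw [← Real.exp_add, ← Real.exp_log (pow_pos h0 (N x)), Real.log_pow]
    congr 1
    simp only [hηdef]
    ring
  have hpow0 : Tendsto (fun x => x ^ N x) (𝓝[<] 1) (𝓝 0) := by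
    have h := (Real.tendsto_exp_neg_atTop_nhds_zero.comp hytop).mul hexpη
    rw [zero_mul] at h
    exact h.congr' (hpow.mono fun x hx => hx.symm)
  have hexpy : ∀ᶠ x in 𝓝[<] 1, Real.exp (-y x) = Real.exp (-t) * (1 - x) ^ 2 / (2 * L x) := by
    filter_upwards [hy, hLpos, hx1] with x h1 h2 h3
    have he : 0 < 1 - x := sub_pos.2 h3
    have : -y x = -t + 2 * Real.log (1 - x) - (Real.log 2 + Real.log (L x)) := by
      rw [h1]
      simp only [hLdef]
      ring
    rw [this, Real.exp_sub, Real.exp_add, Real.exp_add, Real.exp_log two_pos, Real.exp_log h2,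
      two_mul (Real.log (1 - x)), Real.exp_add, Real.exp_log he, sq]
  have hratio : Tendsto (fun x => (N x * (1 - x) + x) / (2 * L x)) (𝓝[<] 1) (𝓝 1) := by
    have hδ : Tendsto (fun x => N x * (1 - x) - y x) (𝓝[<] 1) (𝓝 0) := by
      refine tendsto_of_tendsto_of_tendsto_of_le_of_le' tendsto_const_nhds hεlim ?_ ?_
      · filter_upwards [hNbd] with x h
        linarith [h.1]
      · filter_upwards [hNbd] with x h
        linarith [h.2]
    have h1 := ((hδ.add hxlim).div_atTop hLtop)
    have h2 := (hyL.add h1).div_const 2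
    rw [add_zero, div_self two_ne_zero] at h2
    refine h2.congr' ?_
    filter_upwards [hLpos] with x hx
    field_simp
    ring
  set S : ℝ → ℝ := fun x => x ^ N x * (N x / (1 - x) + x / (1 - x) ^ 2) with hSdef
  have hS : Tendsto S (𝓝[<] 1) (𝓝 (Real.exp (-t))) := by
    have h := (hexpη.mul hratio).const_mul (Real.exp (-t))
    rw [mul_one, mul_one] at h
    refine h.congr' ?_
    filter_upwards [hpow, hexpy, hLpos, hx1] with x h1 h2 h3 h4
    have he : 1 - x ≠ 0 := (sub_pos.2 h4).ne'
    simp only [hSdef]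
    rw [h1, h2]
    field_simp
  have hlow : Tendsto (fun x => Real.exp (-(S x / (1 - x ^ N x)))) (𝓝[<] 1)
      (𝓝 (Real.exp (-Real.exp (-t)))) := by
    have h1 : Tendsto (fun x => 1 - x ^ N x) (𝓝[<] 1) (𝓝 1) := by
      simpa using (tendsto_const_nhds (x := (1 : ℝ))).sub hpow0
    have h2 := hS.div h1 one_ne_zero
    rw [div_one] at h2
    exact (Real.continuous_exp.tendsto _).comp h2.neg
  have hupp : Tendsto (fun x => Real.exp (-S x)) (𝓝[<] 1) (𝓝 (Real.exp (-Real.exp (-t)))) :=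
    (Real.continuous_exp.tendsto _).comp hS.neg
  have hprod : ∀ᶠ x in 𝓝[<] 1,
      (∏' k : ℕ, if N x ≤ k then (1 - x ^ k) ^ k else 1) =
        ∏' k : ℕ, if y x / (1 - x) < (k : ℝ) then (1 - x ^ k) ^ k else 1 := by
    filter_upwards [hypos, hx1] with x h1 h2
    have h : ∀ k : ℕ, N x ≤ k ↔ y x / (1 - x) < (k : ℝ) := fun k => by
      rw [← Nat.floor_lt (div_pos h1 (sub_pos.2 h2)).le]
      exact Nat.succ_le_iff
    simp only [h]
  refine Tendsto.congr' hprod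
    (tendsto_of_tendsto_of_tendsto_of_le_of_le' hlow hupp ?_ ?_)
  · filter_upwards [hx0, hx1] with x h0 h1
    exact (tprod_one_sub_pow_pow_bounds h0 h1 (Nat.succ_ne_zero _)).1
  · filter_upwards [hx0, hx1] with x h0 h1
    exact (tprod_one_sub_pow_pow_bounds h0 h1 (Nat.succ_ne_zero _)).2
end

section
/- Let c > 0 and β > -1 be real, set A(x) = (β+1)|log(1-x)| + β·log|log(1-x)| + β·log(β+1) + log c, and fix real t and δ > 0. Then Σ_{k ∈ ℕ, (A(x)+t)/(1-x) ≤ k ≤ (A(x)+t+δ)/(1-x)} c·k^β·x^k → e^{-t}·(1 - e^{-δ}) as x → 1⁻. -/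
open Filter Topology

/-- If `(1 - x) A(x) → 0` and `n(x)` is within `1` of `(A(x) + s) / (1 - x)`, then
`e^{A(x)} x^{n(x)} → e^{-s}` as `x → 1⁻`. -/
lemma tendsto_exp_mul_pow_of_abs_sub_le (A : ℝ → ℝ) (n : ℝ → ℕ) (s : ℝ)
    (hA : Tendsto (fun x => (1 - x) * A x) (𝓝[<] (1 : ℝ)) (𝓝 0))
    (hn : ∀ᶠ x in 𝓝[<] (1 : ℝ), |(n x : ℝ) - (A x + s) / (1 - x)| ≤ 1) :
    Tendsto (fun x => Real.exp (A x) * x ^ n x) (𝓝[<] (1 : ℝ)) (𝓝 (Real.exp (-s))) := by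
  have hx : Tendsto (fun x : ℝ => x) (𝓝[<] (1 : ℝ)) (𝓝 1) :=
    tendsto_nhdsWithin_of_tendsto_nhds tendsto_id
  have hpos : ∀ᶠ x in 𝓝[<] (1 : ℝ), 0 < x := hx.eventually_const_lt one_pos
  have hlt : ∀ᶠ x in 𝓝[<] (1 : ℝ), x < 1 := eventually_mem_nhdsWithin
  have hlog : Tendsto Real.log (𝓝[<] (1 : ℝ)) (𝓝 0) := by
    simpa using hx.log one_ne_zero
  have hAs : Tendsto (fun x => (1 - x) * (A x + s)) (𝓝[<] (1 : ℝ)) (𝓝 0) := by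
    simpa [mul_add] using hA.add (((tendsto_const_nhds (x := (1 : ℝ))).sub hx).mul_const s)
  have hbound : Tendsto (fun x => |(1 - x) * (A x + s)| / x + |Real.log x|)
      (𝓝[<] (1 : ℝ)) (𝓝 0) := by
    simpa using (hAs.abs.div hx one_ne_zero).add hlog.abs
  have hexp : Tendsto (fun x => A x + s + n x * Real.log x) (𝓝[<] (1 : ℝ)) (𝓝 0) := by
    refine squeeze_zero_norm' ?_ hbound
    filter_upwards [hpos, hlt, hn] with x h0 h1 hnx
    have hε : 0 < 1 - x := sub_pos.2 h1
    have hsplit : A x + s + n x * Real.log x =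
        (A x + s) * (1 + Real.log x / (1 - x))
          + ((n x : ℝ) - (A x + s) / (1 - x)) * Real.log x := by
      field_simp
      ring
    have hlogbound : |1 + Real.log x / (1 - x)| ≤ (1 - x) / x := by
      have hle := Real.log_le_sub_one_of_pos h0
      have hge := Real.one_sub_inv_le_log_of_pos h0
      have e : 1 + Real.log x / (1 - x) = (1 - x + Real.log x) / (1 - x) := by
        field_simp
      rw [e, abs_div, abs_of_pos hε, div_le_iff₀ hε, abs_of_nonpos (by linarith)]
      have e2 : (1 - x) / x * (1 - x) = x⁻¹ - 2 + x := by
        field_simp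
        ring
      linarith
    rw [hsplit, Real.norm_eq_abs]
    refine (abs_add_le _ _).trans (add_le_add ?_ ?_)
    · rw [abs_mul, abs_mul, abs_of_pos hε]
      calc |A x + s| * |1 + Real.log x / (1 - x)| ≤ |A x + s| * ((1 - x) / x) := by gcongr
        _ = (1 - x) * |A x + s| / x := by ring
    · rw [abs_mul]
      exact mul_le_of_le_one_left (abs_nonneg _) hnx
  have hlim := (Real.continuous_exp.tendsto _).comp (hexp.sub_const s)
  rw [zero_sub] at hlim
  refine hlim.congr' ?_
  filter_upwards [hpos] with x h0
  have : x ^ n x = Real.exp (n x * Real.log x) := by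
    rw [Real.exp_nat_mul, Real.exp_log h0]
  rw [this, ← Real.exp_add, Function.comp_apply]
  ring_nf

/-- On a positive interval, a real power lies between its values at the endpoints. -/
lemma rpow_mem_Icc_min_max {a b y : ℝ} (ha : 0 < a) (hay : a ≤ y) (hyb : y ≤ b) (β : ℝ) :
    y ^ β ∈ Set.Icc (min (a ^ β) (b ^ β)) (max (a ^ β) (b ^ β)) := by
  rcases le_total 0 β with h | h
  · exact ⟨min_le_of_left_le (Real.rpow_le_rpow ha.le hay h),
      le_max_of_le_right (Real.rpow_le_rpow (ha.trans_le hay).le hyb h)⟩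
  · exact ⟨min_le_of_right_le (Real.rpow_le_rpow_of_nonpos (ha.trans_le hay) hyb h),
      le_max_of_le_left (Real.rpow_le_rpow_of_nonpos ha hay h)⟩

/-- A sum over the natural numbers in a real window `[a, b]`, `a > 0`, as a finite sum. -/
lemma tsum_window_eq_sum_Ico (f : ℕ → ℝ) {a b : ℝ} (ha : 0 < a) (hab : a ≤ b) :
    (∑' k : ℕ, if a ≤ (k : ℝ) ∧ (k : ℝ) ≤ b then f k else 0)
      = ∑ k ∈ Finset.Ico ⌈a⌉₊ (⌊b⌋₊ + 1), f k := by
  have hmem : ∀ k : ℕ, k ∈ Finset.Ico ⌈a⌉₊ (⌊b⌋₊ + 1) ↔ a ≤ (k : ℝ) ∧ (k : ℝ) ≤ b := by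
    intro k
    rw [Finset.mem_Ico, Nat.lt_succ_iff, Nat.ceil_le, Nat.le_floor_iff (ha.le.trans hab)]
  rw [tsum_eq_sum (s := Finset.Ico ⌈a⌉₊ (⌊b⌋₊ + 1))]
  · exact Finset.sum_congr rfl fun k hk => if_pos ((hmem k).1 hk)
  · exact fun k hk => if_neg fun h => hk ((hmem k).2 h)

/-- **Window sums in the proof of Theorem 4 (order statistics).** With
`A(x) = (β+1)|log(1-x)| + β log|log(1-x)| + β log(β+1) + log c`, the sum of
`c k^β x^k` over `(A(x)+t)/(1-x) ≤ k ≤ (A(x)+t+δ)/(1-x)` converges to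
`e^{-t}(1 - e^{-δ})` as `x → 1⁻`. -/
theorem stmt_12 (c β : ℝ) (hc : 0 < c) (hβ : -1 < β)
    (A : ℝ → ℝ)
    (hA : ∀ x : ℝ, A x = (β + 1) * |Real.log (1 - x)| + β * Real.log |Real.log (1 - x)|
      + β * Real.log (β + 1) + Real.log c)
    (t δ : ℝ) (hδ : 0 < δ) :
    Tendsto (fun x : ℝ => ∑' k : ℕ,
        if (A x + t) / (1 - x) ≤ (k : ℝ) ∧ (k : ℝ) ≤ (A x + t + δ) / (1 - x)
        then c * (k : ℝ) ^ β * x ^ k else 0)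
      (𝓝[<] (1 : ℝ)) (𝓝 (Real.exp (-t) * (1 - Real.exp (-δ)))) := by
  have hβ1 : 0 < β + 1 := by linarith
  have hx : Tendsto (fun x : ℝ => x) (𝓝[<] (1 : ℝ)) (𝓝 1) :=
    tendsto_nhdsWithin_of_tendsto_nhds tendsto_id
  have hpos : ∀ᶠ x in 𝓝[<] (1 : ℝ), 0 < x := hx.eventually_const_lt one_pos
  have hlt : ∀ᶠ x in 𝓝[<] (1 : ℝ), x < 1 := eventually_mem_nhdsWithin
  have hε : Tendsto (fun x : ℝ => 1 - x) (𝓝[<] (1 : ℝ)) (𝓝[>] 0) := by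
    refine tendsto_nhdsWithin_iff.2 ⟨by simpa using hx.const_sub 1, ?_⟩
    filter_upwards [hlt] with x h using sub_pos.2 h
  set L : ℝ → ℝ := fun x => |Real.log (1 - x)| with hLdef
  have hL : Tendsto L (𝓝[<] (1 : ℝ)) atTop :=
    tendsto_abs_atBot_atTop.comp (Real.tendsto_log_nhdsGT_zero.comp hε)
  have hLpos : ∀ᶠ x in 𝓝[<] (1 : ℝ), 0 < L x := hL.eventually_gt_atTop 0
  have hLε : ∀ᶠ x in 𝓝[<] (1 : ℝ), Real.exp (-L x) = 1 - x := by
    filter_upwards [hpos, hlt] with x h0 h1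
    simp only [hLdef]
    rw [abs_of_nonpos (Real.log_nonpos (by linarith) (by linarith)), neg_neg,
      Real.exp_log (by linarith)]
  have hAL : ∀ s : ℝ, Tendsto (fun x => (A x + s) / L x) (𝓝[<] (1 : ℝ)) (𝓝 (β + 1)) := by
    intro s
    have h1 : Tendsto (fun x => Real.log (L x) / L x) (𝓝[<] (1 : ℝ)) (𝓝 0) :=
      Real.isLittleO_log_id_atTop.tendsto_div_nhds_zero.comp hL
    have h2 : Tendsto (fun x => (β * Real.log (β + 1) + Real.log c + s) / L x)
        (𝓝[<] (1 : ℝ)) (𝓝 0) := hL.const_div_atTop _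
    have h3 := ((h1.const_mul β).add h2).const_add (β + 1)
    simp only [mul_zero, add_zero] at h3
    refine h3.congr' ?_
    filter_upwards [hLpos] with x h
    have e : A x = (β + 1) * L x + β * Real.log (L x) + β * Real.log (β + 1) + Real.log c := hA x
    rw [e]
    field_simp
    ring
  have hAt : Tendsto (fun x => A x + t) (𝓝[<] (1 : ℝ)) atTop := by
    refine ((hAL t).pos_mul_atTop hβ1 hL).congr' ?_
    filter_upwards [hLpos] with x h using div_mul_cancel₀ _ h.ne'
  have hεA : Tendsto (fun x => (1 - x) * A x) (𝓝[<] (1 : ℝ)) (𝓝 0) := by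
    have h1 : Tendsto (fun x => L x * Real.exp (-L x)) (𝓝[<] (1 : ℝ)) (𝓝 0) := by
      simpa [Function.comp_def] using (Real.tendsto_pow_mul_exp_neg_atTop_nhds_zero 1).comp hL
    have h2 := (hAL 0).mul h1
    rw [mul_zero] at h2
    refine h2.congr' ?_
    filter_upwards [hLpos, hLε] with x h he
    rw [he, add_zero]
    field_simp
  set a : ℝ → ℝ := fun x => (A x + t) / (1 - x) with ha
  set b : ℝ → ℝ := fun x => (A x + t + δ) / (1 - x) with hb
  have hapos : ∀ᶠ x in 𝓝[<] (1 : ℝ), 0 < a x := by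
    filter_upwards [hlt, hAt.eventually_gt_atTop 0] with x h1 h using div_pos h (sub_pos.2 h1)
  have hab : ∀ᶠ x in 𝓝[<] (1 : ℝ), a x ≤ b x := by
    filter_upwards [hlt] with x h1
    exact div_le_div_of_nonneg_right (by linarith) (sub_pos.2 h1).le
  have hlow : Tendsto (fun x => Real.exp (A x) * x ^ ⌈a x⌉₊) (𝓝[<] (1 : ℝ))
      (𝓝 (Real.exp (-t))) := by
    refine tendsto_exp_mul_pow_of_abs_sub_le A _ t hεA ?_
    filter_upwards [hapos] with x h
    rw [abs_le]
    constructor <;> linarith [Nat.le_ceil (a x), Nat.ceil_lt_add_one h.le]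
  have hupp : Tendsto (fun x => Real.exp (A x) * x ^ (⌊b x⌋₊ + 1)) (𝓝[<] (1 : ℝ))
      (𝓝 (Real.exp (-(t + δ)))) := by
    refine tendsto_exp_mul_pow_of_abs_sub_le A (fun x => ⌊b x⌋₊ + 1) (t + δ) hεA ?_
    filter_upwards [hapos, hab] with x h h'
    rw [← add_assoc, abs_le]
    push_cast
    constructor <;> linarith [Nat.lt_floor_add_one (b x), Nat.floor_le (h.le.trans h')]
  have hG : Tendsto (fun x => Real.exp (A x) * x ^ ⌈a x⌉₊ - Real.exp (A x) * x ^ (⌊b x⌋₊ + 1))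
      (𝓝[<] (1 : ℝ)) (𝓝 (Real.exp (-t) * (1 - Real.exp (-δ)))) := by
    have e : Real.exp (-t) * (1 - Real.exp (-δ)) = Real.exp (-t) - Real.exp (-(t + δ)) := by
      rw [neg_add, Real.exp_add]
      ring
    rw [e]
    exact hlow.sub hupp
  set P : ℝ → ℝ := fun x => (β + 1) * L x / (1 - x) with hP
  have hPpos : ∀ᶠ x in 𝓝[<] (1 : ℝ), 0 < P x := by
    filter_upwards [hlt, hLpos] with x h1 h using div_pos (mul_pos hβ1 h) (sub_pos.2 h1)
  have hratio : ∀ s : ℝ, Tendsto (fun x => ((A x + s) / (1 - x) / P x) ^ β)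
      (𝓝[<] (1 : ℝ)) (𝓝 1) := by
    intro s
    have h1 : Tendsto (fun x => (A x + s) / (1 - x) / P x) (𝓝[<] (1 : ℝ)) (𝓝 1) := by
      have h2 := (hAL s).div_const (β + 1)
      rw [div_self hβ1.ne'] at h2
      refine h2.congr' ?_
      filter_upwards [hlt, hLpos] with x h1 h
      have : 1 - x ≠ 0 := (sub_pos.2 h1).ne'
      simp only [hP]
      field_simp
    simpa using h1.rpow_const (p := β) (Or.inl one_ne_zero)
  have hra : Tendsto (fun x => (a x / P x) ^ β) (𝓝[<] (1 : ℝ)) (𝓝 1) := hratio t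
  have hrb : Tendsto (fun x => (b x / P x) ^ β) (𝓝[<] (1 : ℝ)) (𝓝 1) := by
    simpa only [hb, add_assoc] using hratio (t + δ)
  have hexpA : ∀ᶠ x in 𝓝[<] (1 : ℝ), Real.exp (A x) * (1 - x) = c * P x ^ β := by
    filter_upwards [hlt, hLpos, hLε, hPpos] with x h1 h he hp
    have e : A x = (β + 1) * L x + β * Real.log (L x) + β * Real.log (β + 1) + Real.log c := hA x
    have hlogP : Real.log (P x) = Real.log (β + 1) + Real.log (L x) + L x := by
      simp only [hP]
      rw [Real.log_div (by positivity) (sub_pos.2 h1).ne', Real.log_mul hβ1.ne' h.ne', ← he,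
        Real.log_exp]
      ring
    rw [Real.rpow_def_of_pos hp, ← he, ← Real.exp_add]
    calc Real.exp (A x + -L x) = Real.exp (Real.log c + Real.log (P x) * β) := by
          rw [hlogP, e]
          ring_nf
      _ = c * Real.exp (Real.log (P x) * β) := by rw [Real.exp_add, Real.exp_log hc]
  have hgeom : ∀ᶠ x in 𝓝[<] (1 : ℝ),
      Real.exp (A x) * x ^ ⌈a x⌉₊ - Real.exp (A x) * x ^ (⌊b x⌋₊ + 1)
        = ∑ k ∈ Finset.Ico ⌈a x⌉₊ (⌊b x⌋₊ + 1), c * P x ^ β * x ^ k := by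
    filter_upwards [hlt, hexpA, hab] with x h1 he h
    have hmn : ⌈a x⌉₊ ≤ ⌊b x⌋₊ + 1 :=
      Nat.ceil_le.2 (h.trans (by exact_mod_cast (Nat.lt_floor_add_one (b x)).le))
    rw [← Finset.mul_sum, geom_sum_Ico h1.ne hmn, ← he]
    have : x - 1 ≠ 0 := (sub_neg.2 h1).ne
    field_simp
    ring
  have hsandwich : ∀ᶠ x in 𝓝[<] (1 : ℝ), ∀ k ∈ Finset.Ico ⌈a x⌉₊ (⌊b x⌋₊ + 1),
      min ((a x / P x) ^ β) ((b x / P x) ^ β) * (c * P x ^ β * x ^ k) ≤ c * (k : ℝ) ^ β * x ^ k ∧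
      c * (k : ℝ) ^ β * x ^ k ≤
        max ((a x / P x) ^ β) ((b x / P x) ^ β) * (c * P x ^ β * x ^ k) := by
    filter_upwards [hpos, hPpos, hapos, hab] with x h0 hp hax habx k hk
    rw [Finset.mem_Ico, Nat.lt_succ_iff, Nat.ceil_le, Nat.le_floor_iff (hax.le.trans habx)] at hk
    have hmem := rpow_mem_Icc_min_max (div_pos hax hp)
      (div_le_div_of_nonneg_right hk.1 hp.le) (div_le_div_of_nonneg_right hk.2 hp.le) β
    have e : c * (k : ℝ) ^ β * x ^ k = ((k : ℝ) / P x) ^ β * (c * P x ^ β * x ^ k) := by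
      have : P x ^ β ≠ 0 := (Real.rpow_pos_of_pos hp β).ne'
      rw [Real.div_rpow (Nat.cast_nonneg k) hp.le]
      field_simp
    have hnn : 0 ≤ c * P x ^ β * x ^ k := by positivity
    rw [e]
    exact ⟨mul_le_mul_of_nonneg_right hmem.1 hnn, mul_le_mul_of_nonneg_right hmem.2 hnn⟩
  have hmin := (hra.min hrb).mul hG
  have hmax := (hra.max hrb).mul hG
  rw [min_self, one_mul] at hmin
  rw [max_self, one_mul] at hmax
  refine tendsto_of_tendsto_of_tendsto_of_le_of_le' hmin hmax ?_ ?_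
  · filter_upwards [hgeom, hsandwich, hapos, hab] with x hg hs hax habx
    rw [tsum_window_eq_sum_Ico (fun k => c * (k : ℝ) ^ β * x ^ k) hax habx, hg, Finset.mul_sum]
    exact Finset.sum_le_sum fun k hk => (hs k hk).1
  · filter_upwards [hgeom, hsandwich, hapos, hab] with x hg hs hax habx
    rw [tsum_window_eq_sum_Ico (fun k => c * (k : ℝ) ^ β * x ^ k) hax habx, hg, Finset.mul_sum]
    exact Finset.sum_le_sum fun k hk => (hs k hk).2
end
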